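/- Let d ≥ 1, and let α = r + β with r ∈ ℕ₀ and β ∈ (0,1]. There exist constants c, c′ > 0 depending only on d and α such that for every K ≥ 1 and every h in the unit ball of C^α([0,1]^d), there exists φ ∈ NN(W, D, K) with depth D = 2⌈log₂(d + r)⌉ + 2 and any width W ≥ c′ K^{(2d+α)/(d(D+1)+2)} satisfying sup_{x ∈ [0,1]^d} |h(x) − φ(x)| ≤ c K^{−2α/(2 + d(D+1))}. -/

import Mathlib

open scoped BigOperators

noncomputable section

/-- ReLU activation. -/
def relu (t : ℝ) : ℝ := max 0 t

/-- Squared Frobenius norm of a matrix. -/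
def frobSq {m n : ℕ} (A : Matrix (Fin m) (Fin n) ℝ) : ℝ := ∑ i, ∑ j, (A i j) ^ 2

/-- Frobenius norm of a matrix. -/
def frob {m n : ℕ} (A : Matrix (Fin m) (Fin n) ℝ) : ℝ := Real.sqrt (frobSq A)

/-- Squared Euclidean norm of a vector. -/
def sqNorm {n : ℕ} (v : Fin n → ℝ) : ℝ := ∑ i, (v i) ^ 2

/-- A ReLU network of depth `D`, input dimension `d` and output dimension `k`:
layer widths `N 0 = d, N 1, …, N D, N (D+1) = k`, weight matrices `A ℓ` and biases `b ℓ`. -/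
structure ReluNetwork (D d k : ℕ) where
  N : ℕ → ℕ
  hN0 : N 0 = d
  hNlast : N (D + 1) = k
  A : (ℓ : ℕ) → Matrix (Fin (N (ℓ + 1))) (Fin (N ℓ)) ℝ
  b : (ℓ : ℕ) → Fin (N (ℓ + 1)) → ℝ

namespace ReluNetwork

variable {D d k : ℕ}

/-- Output of the `ℓ`-th hidden layer (after the ReLU). -/
def layer (net : ReluNetwork D d k) : (ℓ : ℕ) → (Fin d → ℝ) → Fin (net.N ℓ) → ℝ
  | 0 => fun x i => x (Fin.cast net.hN0 i)
  | (ℓ + 1) => fun x i =>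
      relu ((∑ j, net.A ℓ i j * net.layer ℓ x j) + net.b ℓ i)

/-- The function realized by the network:
`f_θ(x) = A_D σ(A_{D-1} σ( ⋯ σ(A_0 x + b_0) ⋯ ) + b_{D-1})`. -/
def realize (net : ReluNetwork D d k) (x : Fin d → ℝ) : Fin k → ℝ :=
  fun i => ∑ j, net.A D (Fin.cast net.hNlast.symm i) j * net.layer D x j

/-- Multiplicative Frobenius norm constraint
`κ(θ) = ‖A_D‖_F ∏_{ℓ<D} √(‖A_ℓ‖_F² + ‖b_ℓ‖² + 1)`. -/
def kappa (net : ReluNetwork D d k) : ℝ :=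
  frob (net.A D) *
    ∏ ℓ ∈ Finset.range D, Real.sqrt (frobSq (net.A ℓ) + sqNorm (net.b ℓ) + 1)

/-- All (hidden) layer widths are at most `W`. -/
def widthLe (net : ReluNetwork D d k) (W : ℕ) : Prop :=
  ∀ ℓ, 0 < ℓ → ℓ ≤ D → net.N ℓ ≤ W

end ReluNetwork

/-- The norm-constrained class `NN(W, D, K)` of functions `ℝ^d → ℝ^k` realized by depth-`D`
ReLU networks with all layer widths at most `W` and `κ(θ) ≤ K`. -/
def NNclass (d k W D : ℕ) (K : ℝ) : Set ((Fin d → ℝ) → Fin k → ℝ) :=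
  {f | ∃ net : ReluNetwork D d k, net.widthLe W ∧ net.kappa ≤ K ∧ net.realize = f}

/-- The cube `[a,b]^n` in `ℝ^n` (with the sup norm of the `Pi` type). -/
def cube (n : ℕ) (a b : ℝ) : Set (Fin n → ℝ) := {x | ∀ i, x i ∈ Set.Icc a b}

/-- Partial derivative in the `i`-th coordinate direction. -/
def pd {n : ℕ} (i : Fin n) (h : (Fin n → ℝ) → ℝ) : (Fin n → ℝ) → ℝ :=
  fun x => fderiv ℝ h x (Pi.single i 1)

/-- Multi-index partial derivative `D^s h = ∂_1^{s 1} ⋯ ∂_n^{s n} h`. -/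
def mderiv {n : ℕ} (s : Fin n → ℕ) (h : (Fin n → ℝ) → ℝ) : (Fin n → ℝ) → ℝ :=
  Fin.foldr n (fun i f => (pd i)^[s i] f) h

/-- The multi-indices `s` with `|s| ≤ r`, encoded as functions `Fin n → Fin (r+1)`. -/
def multiIdxLe (n r : ℕ) : Finset (Fin n → Fin (r + 1)) :=
  Finset.univ.filter fun s => (∑ i, (s i : ℕ)) ≤ r

/-- Membership in the unit ball of the Hölder space `C^{r+β}(S)`:
`h` is `r` times continuously differentiable and
`∑_{|γ|≤r} ‖D^γ h‖_{L^∞(S)} + max_{|γ|=r} sup_{x≠y∈S} |D^γ h(x) − D^γ h(y)|/‖x−y‖_∞^β ≤ 1`,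
expressed through bounds `M γ` on the derivatives and `C` on the Hölder seminorms. -/
def HolderUnitBall {n : ℕ} (r : ℕ) (β : ℝ) (S : Set (Fin n → ℝ))
    (h : (Fin n → ℝ) → ℝ) : Prop :=
  ContDiff ℝ r h ∧
  ∃ (M : (Fin n → Fin (r + 1)) → ℝ) (C : ℝ),
    (∀ s ∈ multiIdxLe n r, ∀ x ∈ S, |mderiv (fun i => (s i : ℕ)) h x| ≤ M s) ∧
    (∀ s : Fin n → Fin (r + 1), (∑ i, (s i : ℕ)) = r → ∀ x ∈ S, ∀ y ∈ S,
      |mderiv (fun i => (s i : ℕ)) h x - mderiv (fun i => (s i : ℕ)) h y|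
        ≤ C * ‖x - y‖ ^ β) ∧
    (∑ s ∈ multiIdxLe n r, M s) + C ≤ 1

/-- Hidden layers of a uniform-width network indexed by a finite type. -/
def hid {d : ℕ} {T : Type} [Fintype T] (A0 : T → Fin d → ℝ) (b0 : T → ℝ)
    (A : ℕ → T → T → ℝ) (b : ℕ → T → ℝ) (x : Fin d → ℝ) : ℕ → T → ℝ
  | 0 => fun t => relu ((∑ j, A0 t j * x j) + b0 t)
  | (m + 1) => fun t => relu ((∑ s, A m t s * hid A0 b0 A b x m s) + b m t)

/-- Extension of a function on `Fin n` by zero. -/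
def ext0 {n : ℕ} (f : Fin n → ℝ) (j : ℕ) : ℝ := if h : j < n then f ⟨j, h⟩ else 0

lemma ext0_val {n : ℕ} (f : Fin n → ℝ) (j : Fin n) : ext0 f j.val = f j := by
  simp [ext0]

lemma sum_fin_eq {N n : ℕ} (h : N = n) (F : ℕ → ℝ) :
    ∑ j : Fin N, F j.val = ∑ j : Fin n, F j.val := by
  subst h; rfl

theorem mkNet {d D' W : ℕ} {T : Type} [Fintype T] (A0 : T → Fin d → ℝ) (b0 : T → ℝ)
    (A : ℕ → T → T → ℝ) (b : ℕ → T → ℝ) (a : T → ℝ) (K : ℝ) (hW : Fintype.card T ≤ W)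
    (hK : Real.sqrt (∑ t, a t ^ 2) * (Real.sqrt ((∑ t, ∑ j, A0 t j ^ 2) + ∑ t, b0 t ^ 2 + 1) *
      ∏ m ∈ Finset.range D', Real.sqrt ((∑ t, ∑ s, A m t s ^ 2) + ∑ t, b m t ^ 2 + 1)) ≤ K) :
    (fun x (_ : Fin 1) => ∑ t, a t * hid A0 b0 A b x D' t) ∈ NNclass d 1 W (D' + 1) K := by
  classical
  set n := Fintype.card T with hn
  let e : T ≃ Fin n := Fintype.equivFin T
  let N : ℕ → ℕ := fun ℓ => match ℓ with
    | 0 => d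
    | (m + 1) => if m ≤ D' then n else 1
  let Am : ℕ → ℕ → ℕ → ℝ := fun ℓ i j => match ℓ with
    | 0 => ext0 (fun i : Fin n => ext0 (fun j : Fin d => A0 (e.symm i) j) j) i
    | (m + 1) => if m < D' then
        ext0 (fun i : Fin n => ext0 (fun j : Fin n => A m (e.symm i) (e.symm j)) j) i
        else ext0 (fun j : Fin n => a (e.symm j)) j
  let bm : ℕ → ℕ → ℝ := fun ℓ i => match ℓ with
    | 0 => ext0 (fun i : Fin n => b0 (e.symm i)) i
    | (m + 1) => ext0 (fun i : Fin n => b m (e.symm i)) i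
  have hN0 : N 0 = d := rfl
  have hNs : ∀ m, m ≤ D' → N (m + 1) = n := fun m hm => by simp [N, hm]
  have hNl : N (D' + 1 + 1) = 1 := by simp [N]
  let net : ReluNetwork (D' + 1) d 1 :=
    { N := N, hN0 := hN0, hNlast := hNl
      A := fun ℓ i j => Am ℓ i.val j.val
      b := fun ℓ i => bm ℓ i.val }
  have sumT : ∀ F : T → ℝ, ∑ j : Fin n, F (e.symm j) = ∑ t, F t := fun F =>
    Equiv.sum_comp e.symm F
  have key : ∀ m, m ≤ D' → ∀ x (i : Fin (net.N (m + 1))),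
      net.layer (m + 1) x i = ext0 (fun i : Fin n => hid A0 b0 A b x m (e.symm i)) i.val := by
    intro m
    induction m with
    | zero =>
      intro hm x i
      have hi : i.val < n := by have := i.2; have h2 := hNs 0 hm; change i.val < N (0 + 1) at this; omega
      have e1 : net.layer (0 + 1) x i = relu ((∑ j : Fin d, Am 0 i.val j.val * x j) + bm 0 i.val) := rfl
      rw [e1]
      simp only [Am, bm, ext0, hi, dif_pos, hid, Fin.is_lt, Fin.eta]
    | succ m ih =>
      intro hm x i
      have hi : i.val < n := by
        have := i.2; have h2 := hNs (m+1) hm; change i.val < N (m + 1 + 1) at this; omega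
      have e1 : net.layer (m + 1 + 1) x i = relu ((∑ j : Fin (N (m + 1)),
        Am (m + 1) i.val j.val * net.layer (m + 1) x j) + bm (m + 1) i.val) := rfl
      rw [e1]
      have e2 : ∀ j : Fin (N (m + 1)), Am (m + 1) i.val j.val * net.layer (m + 1) x j
          = Am (m + 1) i.val j.val *
            ext0 (fun i : Fin n => hid A0 b0 A b x m (e.symm i)) j.val := fun j => by
        rw [ih (by omega) x j]
      rw [Finset.sum_congr rfl (fun j _ => e2 j), sum_fin_eq (hNs m (by omega))
        (fun j => Am (m + 1) i.val j * ext0 (fun i : Fin n => hid A0 b0 A b x m (e.symm i)) j)]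
      have hm' : m < D' := by omega
      simp only [Am, bm, ext0, hi, dif_pos, hid, Fin.is_lt, Fin.eta, hm', if_true]
      rw [sumT (fun t => A m (e.symm ⟨i.val, hi⟩) t * hid A0 b0 A b x m t)]
  refine ⟨net, ?_, ?_, ?_⟩
  · intro ℓ h1 h2
    obtain ⟨m, rfl⟩ : ∃ m, ℓ = m + 1 := ⟨ℓ - 1, by omega⟩
    change N (m + 1) ≤ W
    rw [hNs m (by omega)]; exact hW
  · refine le_trans (le_of_eq ?_) hK
    have f1 : frob (net.A (D' + 1)) = Real.sqrt (∑ t, a t ^ 2) := by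
      have : frobSq (net.A (D' + 1)) = ∑ t, a t ^ 2 := by
        change ∑ i : Fin (N (D' + 1 + 1)), ∑ j : Fin (N (D' + 1)), (Am (D' + 1) i.val j.val) ^ 2 = _
        rw [sum_fin_eq hNl (fun i => ∑ j : Fin (N (D' + 1)), (Am (D' + 1) i j.val) ^ 2)]
        simp only [Finset.univ_unique, Finset.sum_singleton]
        rw [sum_fin_eq (hNs D' le_rfl) (fun j => (Am (D' + 1) _ j) ^ 2)]
        simp only [Am, ext0, Fin.is_lt, dif_pos, Fin.eta, lt_irrefl, if_false]
        exact sumT (fun t => a t ^ 2)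
      rw [frob, this]
    have f2 : frobSq (net.A 0) + sqNorm (net.b 0) = (∑ t, ∑ j, A0 t j ^ 2) + ∑ t, b0 t ^ 2 := by
      change ∑ i : Fin (N (0 + 1)), ∑ j : Fin d, (Am 0 i.val j.val) ^ 2
        + ∑ i : Fin (N (0 + 1)), (bm 0 i.val) ^ 2 = _
      rw [sum_fin_eq (hNs 0 (by omega)) (fun i => ∑ j : Fin d, (Am 0 i j.val) ^ 2),
        sum_fin_eq (hNs 0 (by omega)) (fun i => (bm 0 i) ^ 2)]
      simp only [Am, bm, ext0, Fin.is_lt, dif_pos, Fin.eta]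
      rw [sumT (fun t => ∑ j, A0 t j ^ 2), sumT (fun t => b0 t ^ 2)]
    have f3 : ∀ m, m < D' → frobSq (net.A (m + 1)) + sqNorm (net.b (m + 1))
        = (∑ t, ∑ s, A m t s ^ 2) + ∑ t, b m t ^ 2 := by
      intro m hm
      change ∑ i : Fin (N (m + 1 + 1)), ∑ j : Fin (N (m + 1)), (Am (m + 1) i.val j.val) ^ 2
        + ∑ i : Fin (N (m + 1 + 1)), (bm (m + 1) i.val) ^ 2 = _
      rw [sum_fin_eq (hNs (m + 1) (by omega))
          (fun i => ∑ j : Fin (N (m + 1)), (Am (m + 1) i j.val) ^ 2),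
        sum_fin_eq (hNs (m + 1) (by omega)) (fun i => (bm (m + 1) i) ^ 2)]
      have : ∀ i : Fin n, ∑ j : Fin (N (m + 1)), (Am (m + 1) i.val j.val) ^ 2 =
          ∑ s, A m (e.symm i) s ^ 2 := by
        intro i
        rw [sum_fin_eq (hNs m (by omega)) (fun j => (Am (m + 1) i.val j) ^ 2)]
        simp only [Am, ext0, Fin.is_lt, dif_pos, Fin.eta, hm, if_true]
        exact sumT (fun s => A m (e.symm i) s ^ 2)
      rw [Finset.sum_congr rfl (fun i _ => this i)]
      simp only [bm, ext0, Fin.is_lt, dif_pos, Fin.eta]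
      rw [sumT (fun t => ∑ s, A m t s ^ 2), sumT (fun t => b m t ^ 2)]
    rw [ReluNetwork.kappa, f1, Finset.prod_range_succ', f2, mul_comm (∏ _ ∈ _, _)]
    congr 2
    refine Finset.prod_congr rfl fun m hm => ?_
    rw [f3 m (Finset.mem_range.1 hm)]
  · funext x i
    change ∑ j : Fin (N (D' + 1)), Am (D' + 1) _ j.val * net.layer (D' + 1) x j = _
    have e2 : ∀ j : Fin (N (D' + 1)), Am (D' + 1) i.val j.val * net.layer (D' + 1) x j
          = Am (D' + 1) i.val j.val *
            ext0 (fun i : Fin n => hid A0 b0 A b x D' (e.symm i)) j.val := fun j => by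
        rw [key D' le_rfl x j]
    refine (Finset.sum_congr rfl (fun j _ => e2 j)).trans ?_
    rw [sum_fin_eq (hNs D' le_rfl)
        (fun j => Am (D' + 1) i.val j * ext0 (fun i : Fin n => hid A0 b0 A b x D' (e.symm i)) j)]
    simp only [Am, ext0, Fin.is_lt, dif_pos, Fin.eta, lt_irrefl, if_false]
    exact sumT (fun t => a t * hid A0 b0 A b x D' t)


/-- Signs used in the polarization identity. -/
def sg : Fin 4 → ℝ := ![1, 1, -1, -1]
/-- Signs used in the absolute value. -/
def ta : Fin 4 → ℝ := ![1, -1, 1, -1]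
/-- Thresholds. -/
def thr (M : ℕ) (k : Fin M) : ℝ := ((k : ℝ) + 1 / 2) * (2 / M)

/-- Piecewise linear approximation of the square function. -/
def sqA (M : ℕ) (t : ℝ) : ℝ := ∑ k : Fin M, (4 / (M : ℝ)) * (relu (t - thr M k) + relu (-t - thr M k))

/-- Approximate multiplication. -/
def mulA (M : ℕ) (x y : ℝ) : ℝ :=
  (1 / (M : ℝ)) * ∑ q : Fin 4, sg q * ∑ k : Fin M, relu (ta q * (x + sg q * y) - thr M k)

lemma relu_nonneg (t : ℝ) : 0 ≤ relu t := le_max_left _ _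

lemma relu_of_nonneg {t : ℝ} (h : 0 ≤ t) : relu t = t := max_eq_right h

lemma relu_of_nonpos {t : ℝ} (h : t ≤ 0) : relu t = 0 := max_eq_left h

lemma relu_mul {s : ℝ} (hs : 0 ≤ s) (t : ℝ) : relu (s * t) = s * relu t := by
  unfold relu
  rw [mul_max_of_nonneg _ _ hs, mul_zero]

lemma mulA_eq (M : ℕ) (x y : ℝ) : mulA M x y = (sqA M (x + y) - sqA M (x - y)) / 4 := by
  have e : ∀ a b c : ℝ, a + -b = a - b := fun a b _ => by ring
  simp only [mulA, sqA, Fin.sum_univ_four, sg, ta, ← Finset.mul_sum, Finset.sum_add_distrib]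
  simp only [Matrix.cons_val_zero, Matrix.cons_val_one, Matrix.cons_val, one_mul, neg_mul,
    ← sub_eq_add_neg]
  ring

lemma sqA_even (M : ℕ) (t : ℝ) : sqA M (-t) = sqA M t := by
  unfold sqA
  refine Finset.sum_congr rfl fun k _ => ?_
  rw [neg_neg, add_comm]

lemma sqA_nonneg (M : ℕ) (t : ℝ) : 0 ≤ sqA M t :=
  Finset.sum_nonneg fun k _ => mul_nonneg (by positivity)
    (add_nonneg (relu_nonneg _) (relu_nonneg _))

lemma sq_core (h : ℝ) (hh : 0 ≤ h) (M : ℕ) : ∀ t : ℝ, 0 ≤ t → t ≤ (M + 1 / 2) * h →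
    0 ≤ t ^ 2 - ∑ k ∈ Finset.range M, 2 * h * relu (t - (k + 1 / 2) * h) ∧
    t ^ 2 - ∑ k ∈ Finset.range M, 2 * h * relu (t - (k + 1 / 2) * h) ≤ h ^ 2 / 4 := by
  induction M with
  | zero =>
    intro t ht ht2
    simp only [Finset.range_zero, Finset.sum_empty, sub_zero]
    refine ⟨by positivity, ?_⟩
    norm_num at ht2
    nlinarith
  | succ M ih =>
    intro t ht ht2
    by_cases hc : t ≤ (M + 1 / 2) * h
    · rw [Finset.sum_range_succ, relu_of_nonpos (by linarith)]
      simpa using ih t ht hc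
    · push Not at hc
      have e : ∀ n : ℕ, n ≤ M + 1 → ∑ k ∈ Finset.range n, 2 * h * relu (t - (k + 1 / 2) * h)
          = 2 * h * n * t - h ^ 2 * n ^ 2 := by
        intro n
        induction n with
        | zero => simp
        | succ n ihn =>
          intro hn
          have hn' : (n : ℝ) ≤ M := by exact_mod_cast Nat.le_of_succ_le_succ hn
          rw [Finset.sum_range_succ, ihn (by omega), relu_of_nonneg]
          · push_cast; ring
          · have : (n + 1 / 2) * h ≤ (M + 1 / 2) * h := by gcongr
            linarith
      rw [e _ le_rfl]
      push_cast at ht2 ⊢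
      have : t ^ 2 - (2 * h * (M + 1) * t - h ^ 2 * (M + 1) ^ 2) = (t - (M + 1) * h) ^ 2 := by ring
      rw [this]
      refine ⟨sq_nonneg _, ?_⟩
      have h1 : t - (M + 1) * h ≤ h / 2 := by nlinarith
      have h2 : -(h / 2) ≤ t - (M + 1) * h := by nlinarith
      nlinarith

lemma sqA_approx (M : ℕ) (hM : 0 < M) (t : ℝ) (ht : |t| ≤ 2) :
    0 ≤ t ^ 2 - sqA M t ∧ t ^ 2 - sqA M t ≤ 1 / (M : ℝ) ^ 2 := by
  have hM' : (0 : ℝ) < M := by exact_mod_cast hM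
  have main : ∀ t : ℝ, 0 ≤ t → t ≤ 2 → 0 ≤ t ^ 2 - sqA M t ∧ t ^ 2 - sqA M t ≤ 1 / (M : ℝ) ^ 2 := by
    intro t h0 h2
    have e : sqA M t = ∑ k ∈ Finset.range M, 2 * (2 / M : ℝ) * relu (t - (k + 1 / 2) * (2 / M : ℝ)) := by
      rw [Finset.sum_range]
      refine Finset.sum_congr rfl fun k _ => ?_
      have hthr : 0 ≤ thr M k := by unfold thr; positivity
      rw [relu_of_nonpos (t := -t - thr M k) (by linarith), thr]
      ring
    rw [e]
    have := sq_core (2 / M) (by positivity) M t h0 (by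
      have : ((M : ℝ) + 1 / 2) * (2 / M) = 2 + 1 / M := by field_simp
      rw [this]
      have : 0 < 1 / (M : ℝ) := by positivity
      linarith)
    refine ⟨this.1, this.2.trans (le_of_eq ?_)⟩
    field_simp
    norm_num
  rcases le_total 0 t with h | h
  · exact main t h (by rwa [abs_of_nonneg h] at ht)
  · have := main (-t) (by linarith) (by rwa [abs_of_nonpos h] at ht)
    rwa [sqA_even, neg_sq] at this

lemma mulA_bound (M : ℕ) (hM : 0 < M) (x y : ℝ) (hx : |x| ≤ 1) (hy : |y| ≤ 1) :
    |mulA M x y| ≤ 1 ∧ |mulA M x y - x * y| ≤ 1 / (M : ℝ) ^ 2 := by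
  have hx' := abs_le.1 hx
  have hy' := abs_le.1 hy
  have p := sqA_approx M hM (x + y) (abs_le.2 ⟨by linarith, by linarith⟩)
  have m := sqA_approx M hM (x - y) (abs_le.2 ⟨by linarith, by linarith⟩)
  have p0 := sqA_nonneg M (x + y)
  have m0 := sqA_nonneg M (x - y)
  have hh : 0 ≤ 1 / (M : ℝ) ^ 2 := by positivity
  rw [mulA_eq]
  constructor
  · rw [abs_le]; constructor <;> nlinarith
  · rw [abs_le]; constructor <;> nlinarith

lemma mulA_zero_left (M : ℕ) (y : ℝ) : mulA M 0 y = 0 := by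
  rw [mulA_eq, zero_add, zero_sub, sqA_even]; simp

lemma mulA_zero_right (M : ℕ) (x : ℝ) : mulA M x 0 = 0 := by
  rw [mulA_eq]; simp

/-- Approximate products over cyclic windows. -/
def valA {J : Type} [AddCommMonoidWithOne J] (M : ℕ) (g : J → ℝ) : ℕ → J → ℝ
  | 0 => g
  | (m + 1) => fun j => mulA M (valA M g m j) (valA M g m (j + ((2 ^ m : ℕ) : J)))

lemma valA_bound {J : Type} [AddCommMonoidWithOne J] (M : ℕ) (hM : 0 < M) (g : J → ℝ)
    (hg : ∀ j, |g j| ≤ 1) (m : ℕ) : ∀ j, |valA M g m j| ≤ 1 := by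
  induction m with
  | zero => exact hg
  | succ m ih => intro j; exact (mulA_bound M hM _ _ (ih _) (ih _)).1

lemma prod_abs_le_one {J : Type} (g : J → ℝ) (hg : ∀ j, |g j| ≤ 1) (s : Finset ℕ) (f : ℕ → J) :
    |∏ i ∈ s, g (f i)| ≤ 1 := by
  rw [Finset.abs_prod]
  exact Finset.prod_le_one (fun _ _ => abs_nonneg _) (fun _ _ => hg _)

lemma valA_approx {J : Type} [AddCommMonoidWithOne J] (M : ℕ) (hM : 0 < M) (g : J → ℝ)
    (hg : ∀ j, |g j| ≤ 1) (m : ℕ) : ∀ j,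
    |valA M g m j - ∏ i ∈ Finset.range (2 ^ m), g (j + (i : J))| ≤ (2 ^ m - 1) * (1 / (M : ℝ) ^ 2) := by
  induction m with
  | zero => intro j; simp [valA]
  | succ m ih =>
    intro j
    have e : ∏ i ∈ Finset.range (2 ^ (m + 1)), g (j + (i : J)) =
        (∏ i ∈ Finset.range (2 ^ m), g (j + (i : J))) *
        ∏ i ∈ Finset.range (2 ^ m), g (j + ((2 ^ m : ℕ) : J) + (i : J)) := by
      rw [pow_succ, mul_two, Finset.prod_range_add]
      congr 1
      refine Finset.prod_congr rfl fun i _ => ?_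
      rw [Nat.cast_add, add_assoc]
    rw [e]
    set X := ∏ i ∈ Finset.range (2 ^ m), g (j + (i : J)) with hX
    set Y := ∏ i ∈ Finset.range (2 ^ m), g (j + ((2 ^ m : ℕ) : J) + (i : J)) with hY
    have h1 := ih j
    have h2 := ih (j + ((2 ^ m : ℕ) : J))
    rw [← hX] at h1
    rw [← hY] at h2
    have b1 := valA_bound M hM g hg m j
    have b2 := valA_bound M hM g hg m (j + ((2 ^ m : ℕ) : J))
    have bY : |Y| ≤ 1 := prod_abs_le_one g hg _ _
    have h3 := (mulA_bound M hM _ _ b1 b2).2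
    change |mulA M (valA M g m j) (valA M g m (j + ((2 ^ m : ℕ) : J))) - X * Y| ≤ _
    set x := valA M g m j
    set y := valA M g m (j + ((2 ^ m : ℕ) : J))
    have e2 : mulA M x y - X * Y = (mulA M x y - x * y) + x * (y - Y) + (x - X) * Y := by ring
    rw [e2]
    refine (abs_add_three _ _ _).trans ?_
    rw [abs_mul, abs_mul]
    have h4 : |x| * |y - Y| ≤ 1 * |y - Y| := by gcongr
    have h5 : |x - X| * |Y| ≤ |x - X| * 1 := by gcongr
    have : ((2 : ℝ) ^ (m + 1) - 1) * (1 / (M : ℝ) ^ 2) = 1 / (M : ℝ) ^ 2 +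
      (2 ^ m - 1) * (1 / (M : ℝ) ^ 2) + (2 ^ m - 1) * (1 / (M : ℝ) ^ 2) := by ring
    rw [this]
    linarith

lemma valA_zero {J : Type} [AddCommMonoidWithOne J] (M : ℕ) (g : J → ℝ) (m : ℕ) : ∀ j,
    (∃ i : ℕ, i < 2 ^ m ∧ g (j + (i : J)) = 0) → valA M g m j = 0 := by
  induction m with
  | zero => rintro j ⟨i, hi, h⟩
            have : i = 0 := by simpa using hi
            subst this; simpa [valA] using h
  | succ m ih =>
    rintro j ⟨i, hi, h⟩
    change mulA M (valA M g m j) (valA M g m (j + ((2 ^ m : ℕ) : J))) = 0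
    by_cases hc : i < 2 ^ m
    · rw [ih j ⟨i, hc, h⟩, mulA_zero_left]
    · rw [ih (j + ((2 ^ m : ℕ) : J)) ⟨i - 2 ^ m, by rw [pow_succ] at hi; omega, ?_⟩, mulA_zero_right]
      rw [add_assoc, ← Nat.cast_add, Nat.add_sub_cancel' (by omega)]
      exact h


/-- Value of a leaf (a piecewise linear function of one coordinate). -/
def leafE {d : ℕ} (i : Fin d) (w b c : Fin 4 → ℝ) (x : Fin d → ℝ) : ℝ :=
  ∑ q, c q * relu (w q * x i + b q)

/-- Output coefficients at level `m`. -/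
def oc {P J : Type} (lc : P → J → Fin 4 → ℝ) : ℕ → P → J → Fin 4 → ℝ
  | 0 => lc
  | (_ + 1) => fun _ _ q => sg q

lemma sg_sq (q : Fin 4) : sg q ^ 2 = 1 := by fin_cases q <;> simp [sg]
lemma ta_sq (q : Fin 4) : ta q ^ 2 = 1 := by fin_cases q <;> simp [ta]

section treenet

set_option linter.unusedSectionVars false

variable {d : ℕ} {P J : Type} [Fintype P] [Fintype J] [DecidableEq P] [DecidableEq J]
  [AddCommMonoidWithOne J] (M : ℕ)
  (li : P → J → Fin d) (lw lb lc : P → J → Fin 4 → ℝ) (coef : P → ℝ)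

/-- Normalization. -/
def sM (M : ℕ) : ℝ := 1 / Real.sqrt M

/-- First weights. -/
def tA0 : (P × J × Fin 4 × Fin M) → Fin d → ℝ := fun t i =>
  sM M * (if i = li t.1 t.2.1 then lw t.1 t.2.1 t.2.2.1 else 0)
/-- First biases. -/
def tb0 : (P × J × Fin 4 × Fin M) → ℝ := fun t => sM M * lb t.1 t.2.1 t.2.2.1
/-- Hidden weights. -/
def tA : ℕ → (P × J × Fin 4 × Fin M) → (P × J × Fin 4 × Fin M) → ℝ := fun m t t' =>
  if t'.1 = t.1 then
    (sM M * (ta t.2.2.1 * ((if t'.2.1 = t.2.1 then 1 else 0) +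
      sg t.2.2.1 * (if t'.2.1 = t.2.1 + ((2 ^ m : ℕ) : J) then 1 else 0)))) *
    (sM M * oc lc m t'.1 t'.2.1 t'.2.2.1)
  else 0
/-- Hidden biases. -/
def tb : ℕ → (P × J × Fin 4 × Fin M) → ℝ := fun _ t => -(sM M * thr M t.2.2.2)
/-- Output weights. -/
def ta' (D' : ℕ) : (P × J × Fin 4 × Fin M) → ℝ := fun t =>
  if t.2.1 = 0 then coef t.1 * (sM M * oc lc D' t.1 t.2.1 t.2.2.1) else 0

lemma sM_sq (hM : 0 < M) : (M : ℝ) * (sM M * sM M) = 1 := by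
  have hM' : (0 : ℝ) < M := by exact_mod_cast hM
  have : Real.sqrt M * Real.sqrt M = M := Real.mul_self_sqrt hM'.le
  unfold sM
  have h2 : Real.sqrt M ≠ 0 := (Real.sqrt_pos.2 hM').ne'
  field_simp
  linarith [this, sq (Real.sqrt M)]

lemma sM_nonneg : 0 ≤ sM M := by unfold sM; positivity

lemma tree_val (hM : 0 < M) (x : Fin d → ℝ) (m : ℕ) : ∀ (p : P) (j : J),
    ∑ q : Fin 4, ∑ k : Fin M, (sM M * oc lc m p j q) *
      hid (tA0 M li lw) (tb0 M lb) (tA (J := J) M lc) (tb M) x m (p, j, q, k)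
    = valA M (fun j => leafE (li p j) (lw p j) (lb p j) (lc p j) x) m j := by
  have hs := sM_sq M hM
  induction m with
  | zero =>
    intro p j
    simp only [hid, valA, leafE, tA0, tb0, oc]
    refine Finset.sum_congr rfl fun q _ => ?_
    have : ∀ k : Fin M, sM M * lc p j q * relu ((∑ i, sM M * (if i = li p j then lw p j q else 0) * x i)
        + sM M * lb p j q) = (sM M * sM M) * (lc p j q * relu (lw p j q * x (li p j) + lb p j q)) := by
      intro k
      have : (∑ i, sM M * (if i = li p j then lw p j q else 0) * x i)
        + sM M * lb p j q = sM M * (lw p j q * x (li p j) + lb p j q) := by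
        simp [mul_ite, ite_mul, mul_add, mul_assoc]
      rw [this, relu_mul (sM_nonneg M)]
      ring
    rw [Finset.sum_congr rfl fun k _ => this k, Finset.sum_const, Finset.card_univ, Fintype.card_fin,
      nsmul_eq_mul, ← mul_assoc, hs, one_mul]
  | succ m ih =>
    intro p j
    set g := fun j => leafE (li p j) (lw p j) (lb p j) (lc p j) x with hg
    have hh : ∀ q k, hid (tA0 M li lw) (tb0 M lb) (tA (J := J) M lc) (tb M) x (m + 1) (p, j, q, k)
        = sM M * relu (ta q * (valA M g m j + sg q * valA M g m (j + ((2 ^ m : ℕ) : J))) - thr M k) := by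
      intro q k
      rw [← relu_mul (sM_nonneg M), hid]
      beta_reduce
      congr 1
      rw [Fintype.sum_prod_type, Fintype.sum_eq_single p]
      · rw [Fintype.sum_prod_type]
        have : ∀ j', ∑ y : Fin 4 × Fin M, tA (J := J) M lc m (p, j, q, k) (p, j', y) *
            hid (tA0 M li lw) (tb0 M lb) (tA (J := J) M lc) (tb M) x m (p, j', y)
            = (sM M * (ta q * ((if j' = j then 1 else 0) +
              sg q * (if j' = j + ((2 ^ m : ℕ) : J) then 1 else 0)))) * valA M g m j' := by
          intro j'
          rw [← ih p j', Fintype.sum_prod_type, Finset.mul_sum]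
          refine Finset.sum_congr rfl fun q' _ => ?_
          rw [Finset.mul_sum]
          refine Finset.sum_congr rfl fun k' _ => ?_
          simp only [tA, if_true]
          ring
        rw [Finset.sum_congr rfl fun j' _ => this j']
        have e2 : ∀ j', (sM M * (ta q * ((if j' = j then 1 else 0) +
              sg q * (if j' = j + ((2 ^ m : ℕ) : J) then 1 else 0)))) * valA M g m j'
            = (if j' = j then sM M * ta q * valA M g m j' else 0) +
              (if j' = j + ((2 ^ m : ℕ) : J) then sM M * ta q * sg q * valA M g m j' else 0) := by
          intro j'
          split_ifs <;> ring
        rw [Finset.sum_congr rfl fun j' _ => e2 j', Finset.sum_add_distrib,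
          Finset.sum_ite_eq' Finset.univ j, Finset.sum_ite_eq' Finset.univ (j + ((2 ^ m : ℕ) : J))]
        simp only [Finset.mem_univ, if_true, tb]
        ring
      · intro p' hp'
        refine Finset.sum_eq_zero fun y _ => ?_
        simp [tA, hp']
    simp only [hh, oc, valA, mulA]
    rw [Finset.mul_sum]
    refine Finset.sum_congr rfl fun q _ => ?_
    rw [Finset.mul_sum, Finset.mul_sum]
    refine Finset.sum_congr rfl fun k _ => ?_
    have : 1 / (M : ℝ) = sM M * sM M := by
      have hM' : (0 : ℝ) < M := by exact_mod_cast hM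
      field_simp; linarith
    rw [this]; ring

lemma sum_const_T (hM : 0 < M) (C : ℝ) : ∑ _t : P × J × Fin 4 × Fin M, (sM M * sM M) * C =
    4 * (Fintype.card P) * (Fintype.card J) * C := by
  rw [Finset.sum_const, Finset.card_univ, nsmul_eq_mul]
  simp only [Fintype.card_prod, Fintype.card_fin]
  push_cast
  have := sM_sq M hM
  linear_combination (4 * (Fintype.card P) * (Fintype.card J) * C) * this

lemma oc_sq (hc : ∀ p j q, |lc p j q| ≤ 2) (m : ℕ) (p : P) (j : J) (q : Fin 4) :
    oc lc m p j q ^ 2 ≤ 4 := by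
  cases m with
  | zero => have := hc p j q
            simp only [oc]
            rw [← sq_abs]
            nlinarith [abs_nonneg (lc p j q)]
  | succ m => simp only [oc, sg_sq]; norm_num

theorem tree_net [Nonempty P] [Nonempty J] (hM : 0 < M) (D' W : ℕ) (K N : ℝ) (hN : 1 ≤ N)
    (hw : ∀ p j q, |lw p j q| ≤ N) (hb : ∀ p j q, |lb p j q| ≤ 2 * N)
    (hc : ∀ p j q, |lc p j q| ≤ 2) (hcoef : ∀ p, |coef p| ≤ 1)
    (hW : Fintype.card P * Fintype.card J * 4 * M ≤ W)
    (hK : N * Real.sqrt (300 * Fintype.card P * (Fintype.card J) ^ 2) ^ (D' + 2) ≤ K) :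
    (fun x (_ : Fin 1) => ∑ p, coef p *
      valA M (fun j => leafE (li p j) (lw p j) (lb p j) (lc p j) x) D' 0)
      ∈ NNclass d 1 W (D' + 1) K := by
  have hs := sM_sq M hM
  have hs0 := sM_nonneg M
  have hP : (1 : ℝ) ≤ Fintype.card P := by exact_mod_cast Fintype.card_pos
  have hJ : (1 : ℝ) ≤ Fintype.card J := by exact_mod_cast Fintype.card_pos
  set cP : ℝ := ((Fintype.card P : ℕ) : ℝ)
  set cJ : ℝ := ((Fintype.card J : ℕ) : ℝ)
  set B : ℝ := 300 * cP * cJ ^ 2 with hB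
  have hPJ : 1 ≤ cP * cJ := by nlinarith
  have hPJJ : cP * cJ ≤ cP * cJ ^ 2 := by nlinarith
  have hocs := oc_sq lc hc
  have key := mkNet (d := d) (D' := D') (W := W) (tA0 M li lw) (tb0 M lb) (tA (J := J) M lc) (tb M)
    (ta' (J := J) M lc coef D') K (by simp only [Fintype.card_prod, Fintype.card_fin]; linarith) (by
    refine le_trans ?_ hK
    have s1 : Real.sqrt (∑ t, ta' (J := J) M lc coef D' t ^ 2) ≤ Real.sqrt B := by
      apply Real.sqrt_le_sqrt
      have : ∀ t, ta' (J := J) M lc coef D' t ^ 2 ≤ (sM M * sM M) * 4 := by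
        intro t
        unfold ta'
        have h1 := hocs D' t.1 t.2.1 t.2.2.1
        have h2 : coef t.1 ^ 2 ≤ 1 := by
          rw [← sq_abs]; have := hcoef t.1; nlinarith [abs_nonneg (coef t.1)]
        split_ifs
        · have e : (coef t.1 * (sM M * oc lc D' t.1 t.2.1 t.2.2.1)) ^ 2 =
            (sM M * sM M) * (coef t.1 ^ 2 * oc lc D' t.1 t.2.1 t.2.2.1 ^ 2) := by ring
          rw [e]
          refine mul_le_mul_of_nonneg_left ?_ (mul_nonneg hs0 hs0)
          nlinarith [sq_nonneg (coef t.1), sq_nonneg (oc lc D' t.1 t.2.1 t.2.2.1)]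
        · have := mul_nonneg hs0 hs0
          simp only [ne_eq, OfNat.ofNat_ne_zero, not_false_eq_true, zero_pow]
          linarith
      refine (Finset.sum_le_sum fun t _ => this t).trans ?_
      rw [sum_const_T M hM]
      change 4 * cP * cJ * 4 ≤ B
      rw [hB]; nlinarith
    have s2 : Real.sqrt ((∑ t, ∑ j, tA0 M li lw t j ^ 2) + ∑ t, tb0 M lb t ^ 2 + 1)
        ≤ N * Real.sqrt B := by
      have e : N * Real.sqrt B = Real.sqrt (N ^ 2 * B) := by
        rw [Real.sqrt_mul (sq_nonneg N) B, Real.sqrt_sq (by linarith)]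
      rw [e]
      apply Real.sqrt_le_sqrt
      have b1 : ∀ t, ∑ j, tA0 M li lw t j ^ 2 ≤ (sM M * sM M) * N ^ 2 := by
        intro t
        have : ∀ j, tA0 M li lw t j ^ 2 =
          if j = li t.1 t.2.1 then (sM M * lw t.1 t.2.1 t.2.2.1) ^ 2 else 0 := by
          intro j
          unfold tA0
          split_ifs <;> simp
        rw [Finset.sum_congr rfl fun j _ => this j, Finset.sum_ite_eq' Finset.univ (li t.1 t.2.1)]
        simp only [Finset.mem_univ, if_true]
        have h2 : lw t.1 t.2.1 t.2.2.1 ^ 2 ≤ N ^ 2 := by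
          rw [← sq_abs]; exact pow_le_pow_left₀ (abs_nonneg _) (hw _ _ _) 2
        have e : (sM M * lw t.1 t.2.1 t.2.2.1) ^ 2 = (sM M * sM M) * lw t.1 t.2.1 t.2.2.1 ^ 2 := by ring
        rw [e]
        exact mul_le_mul_of_nonneg_left h2 (mul_nonneg hs0 hs0)
      have b2 : ∀ t, tb0 M lb t ^ 2 ≤ (sM M * sM M) * (2 * N) ^ 2 := by
        intro t
        have h2 : lb t.1 t.2.1 t.2.2.1 ^ 2 ≤ (2 * N) ^ 2 := by
          rw [← sq_abs]; exact pow_le_pow_left₀ (abs_nonneg _) (hb _ _ _) 2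
        have e : tb0 M lb t ^ 2 = (sM M * sM M) * lb t.1 t.2.1 t.2.2.1 ^ 2 := by unfold tb0; ring
        rw [e]
        exact mul_le_mul_of_nonneg_left h2 (mul_nonneg hs0 hs0)
      have c1 := Finset.sum_le_sum fun t (_ : t ∈ Finset.univ) => b1 t
      have c2 := Finset.sum_le_sum fun t (_ : t ∈ Finset.univ) => b2 t
      rw [sum_const_T M hM] at c1 c2
      change _ ≤ 4 * cP * cJ * _ at c1
      change _ ≤ 4 * cP * cJ * _ at c2
      have hN2 : 1 ≤ N ^ 2 := by nlinarith
      have c3 : 1 ≤ N ^ 2 * (cP * cJ) := by nlinarith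
      have c4 : N ^ 2 * (cP * cJ) ≤ N ^ 2 * (cP * cJ ^ 2) := by gcongr
      rw [hB]
      linarith
    have s3 : ∀ m ∈ Finset.range D', Real.sqrt ((∑ t, ∑ s, tA (J := J) M lc m t s ^ 2)
        + ∑ t : P × J × Fin 4 × Fin M, tb (P := P) (J := J) M m t ^ 2 + 1) ≤ Real.sqrt B := by
      intro m _
      apply Real.sqrt_le_sqrt
      have b1 : ∀ t, ∑ s, tA (J := J) M lc m t s ^ 2 ≤ (sM M * sM M) * (64 * cJ) := by
        intro t
        rw [Fintype.sum_prod_type, Fintype.sum_eq_single t.1]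
        · have : ∀ y, tA (J := J) M lc m t (t.1, y) ^ 2 ≤ (sM M * sM M) * ((sM M * sM M) * 16) := by
            intro y
            have h1 := hocs m t.1 y.1 y.2.1
            have e : tA (J := J) M lc m t (t.1, y) ^ 2 = (sM M * sM M) * ((sM M * sM M) *
              ((((if y.1 = t.2.1 then 1 else 0) +
      sg t.2.2.1 * (if y.1 = t.2.1 + ((2 ^ m : ℕ) : J) then 1 else 0)) ^ 2) *
                oc lc m t.1 y.1 y.2.1 ^ 2)) := by
              simp only [tA, if_true]
              have := ta_sq t.2.2.1
              rw [mul_pow, mul_pow, mul_pow, mul_pow, this]; ring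
            rw [e]
            refine mul_le_mul_of_nonneg_left (mul_le_mul_of_nonneg_left ?_ (mul_nonneg hs0 hs0))
              (mul_nonneg hs0 hs0)
            have h3 : ((if y.1 = t.2.1 then (1:ℝ) else 0) +
                sg t.2.2.1 * (if y.1 = t.2.1 + ((2 ^ m : ℕ) : J) then 1 else 0)) ^ 2 ≤ 4 := by
              have := sg_sq t.2.2.1
              split_ifs <;> nlinarith [sq_nonneg (sg t.2.2.1 - 1)]
            calc _ ≤ (4 : ℝ) * 4 := mul_le_mul h3 h1 (sq_nonneg _) (by norm_num)
              _ = 16 := by norm_num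
          refine (Finset.sum_le_sum fun y _ => this y).trans ?_
          rw [← Finset.mul_sum, Finset.sum_const, Finset.card_univ, nsmul_eq_mul]
          refine mul_le_mul_of_nonneg_left (le_of_eq ?_) (mul_nonneg hs0 hs0)
          simp only [Fintype.card_prod, Fintype.card_fin]
          push_cast
          change cJ * (4 * M) * (sM M * sM M * 16) = _
          linear_combination (64 * cJ) * hs
        · intro p' hp'
          refine Finset.sum_eq_zero fun y _ => ?_
          simp [tA, hp']
      have b2 : ∀ t, tb (P := P) (J := J) M m t ^ 2 ≤ (sM M * sM M) * 4 := by
        intro t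
        have hM' : (0 : ℝ) < M := by exact_mod_cast hM
        have h0 : 0 ≤ thr M t.2.2.2 := by unfold thr; positivity
        have h1 : thr M t.2.2.2 ≤ 2 := by
          unfold thr
          have : ((t.2.2.2 : ℕ) : ℝ) + 1 ≤ M := by exact_mod_cast t.2.2.2.2
          rw [mul_div_assoc', div_le_iff₀ hM']
          nlinarith
        have e : tb (P := P) (J := J) M m t ^ 2 = (sM M * sM M) * thr M t.2.2.2 ^ 2 := by
          unfold tb; ring
        rw [e]
        refine mul_le_mul_of_nonneg_left (by nlinarith) (mul_nonneg hs0 hs0)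
      have c1 := Finset.sum_le_sum fun t (_ : t ∈ Finset.univ) => b1 t
      have c2 := Finset.sum_le_sum fun t (_ : t ∈ Finset.univ) => b2 t
      rw [sum_const_T M hM] at c1 c2
      change _ ≤ 4 * cP * cJ * _ at c1
      change _ ≤ 4 * cP * cJ * _ at c2
      rw [hB]
      nlinarith
    have s4 := Finset.prod_le_prod (s := Finset.range D') (fun m _ => Real.sqrt_nonneg _) s3
    rw [Finset.prod_const, Finset.card_range] at s4
    calc _ ≤ Real.sqrt B * (N * Real.sqrt B * Real.sqrt B ^ D') := by
          refine mul_le_mul s1 (mul_le_mul s2 s4 ?_ ?_) ?_ (Real.sqrt_nonneg _)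
          · exact Finset.prod_nonneg fun m _ => Real.sqrt_nonneg _
          · exact mul_nonneg (by linarith) (Real.sqrt_nonneg _)
          · exact mul_nonneg (Real.sqrt_nonneg _) (Finset.prod_nonneg fun m _ => Real.sqrt_nonneg _)
      _ = N * Real.sqrt B ^ (D' + 2) := by ring)
  convert key using 1
  funext x _
  rw [Fintype.sum_prod_type]
  refine Finset.sum_congr rfl fun p _ => ?_
  rw [Fintype.sum_prod_type, Fintype.sum_eq_single 0]
  · rw [← tree_val M li lw lb lc hM x D' p 0, Fintype.sum_prod_type, Finset.mul_sum]
    refine Finset.sum_congr rfl fun q _ => ?_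
    rw [Finset.mul_sum]
    refine Finset.sum_congr rfl fun k _ => ?_
    simp only [ta', if_true]
    ring
  · intro j hj
    refine Finset.sum_eq_zero fun y _ => ?_
    simp [ta', hj]

end treenet


lemma taylor1 (β C : ℝ) (hβ : 0 < β) (hC : 0 ≤ C) (m : ℕ) : ∀ (g : ℕ → ℝ → ℝ) (t : ℝ),
    (∀ k < m, ∀ τ, HasDerivAt (g k) (g (k + 1) τ) τ) →
    (∀ τ ∈ Set.uIcc 0 t, |g m τ - g m 0| ≤ C * |τ| ^ β) →
    |g 0 t - ∑ k ∈ Finset.range (m + 1), g k 0 * (t ^ k / (Nat.factorial k : ℝ))| ≤ C * |t| ^ ((m : ℝ) + β) := by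
  induction m with
  | zero =>
    intro g t _ h
    simpa using h t Set.right_mem_uIcc
  | succ m ih =>
    intro g t hd hH
    let R : ℝ → ℝ := fun τ => g 0 τ - ∑ k ∈ Finset.range (m + 1 + 1), g k 0 * (τ ^ k / (Nat.factorial k : ℝ))
    let R' : ℝ → ℝ := fun τ => g 1 τ - ∑ k ∈ Finset.range (m + 1), g (k + 1) 0 * (τ ^ k / (Nat.factorial k : ℝ))
    have hR : ∀ τ, HasDerivAt R (R' τ) τ := by
      intro τ
      refine (hd 0 (by omega) τ).sub ?_
      have e : (fun τ : ℝ => ∑ k ∈ Finset.range (m + 1 + 1), g k 0 * (τ ^ k / (Nat.factorial k : ℝ))) =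
        fun τ : ℝ => ∑ k ∈ Finset.range (m + 1), g (k + 1) 0 * (τ ^ (k + 1) / (Nat.factorial (k + 1) : ℝ))
          + g 0 0 := by
        funext τ
        rw [Finset.sum_range_succ']
        simp
      have e2 : HasDerivAt (fun τ : ℝ => ∑ k ∈ Finset.range (m + 1), g (k + 1) 0 *
          (τ ^ (k + 1) / (Nat.factorial (k + 1) : ℝ)) + g 0 0)
          (∑ k ∈ Finset.range (m + 1), g (k + 1) 0 * (τ ^ k / (Nat.factorial k : ℝ))) τ := by
        refine HasDerivAt.add_const _ ?_
        refine HasDerivAt.fun_sum fun k _ => ?_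
        refine HasDerivAt.const_mul _ ?_
        have := (hasDerivAt_pow (k + 1) τ).div_const (Nat.factorial (k + 1) : ℝ)
        convert this using 1
        rw [Nat.factorial_succ]
        have h1 : (Nat.factorial k : ℝ) ≠ 0 := by exact_mod_cast Nat.factorial_ne_zero k
        push_cast
        field_simp
      rw [← e] at e2
      exact e2
    have hb : ∀ τ ∈ Set.uIcc 0 t, ‖R' τ‖ ≤ C * |t| ^ ((m : ℝ) + β) := by
      intro τ hτ
      have hτt : |τ| ≤ |t| := by simpa using Set.abs_sub_left_of_mem_uIcc hτ
      have := ih (fun k => g (k + 1)) τ (fun k hk τ => hd (k + 1) (by omega) τ)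
        (fun σ hσ => hH σ (Set.uIcc_subset_uIcc_left hτ hσ))
      rw [Real.norm_eq_abs]
      refine this.trans ?_
      gcongr
    have := Convex.norm_image_sub_le_of_norm_hasDerivWithin_le (f := R) (f' := R')
      (fun τ _ => (hR τ).hasDerivWithinAt) hb (convex_uIcc 0 t) Set.left_mem_uIcc Set.right_mem_uIcc
    have R0 : R 0 = 0 := by
      simp only [R]
      rw [Finset.sum_range_succ']
      simp
    rw [R0, sub_zero, sub_zero, Real.norm_eq_abs, Real.norm_eq_abs] at this
    have e3 : |t| ^ (((m + 1 : ℕ) : ℝ) + β) = |t| ^ ((m : ℝ) + β) * |t| := by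
      rw [← Real.rpow_add_one' (abs_nonneg _) (by positivity)]
      congr 1
      push_cast; ring
    rw [e3, ← mul_assoc]
    exact this

section taylor
variable {E : Type} [NormedAddCommGroup E] [NormedSpace ℝ E]

/-- Directional derivative. -/
def dirD (v : E) (f : E → ℝ) : E → ℝ := fun x => fderiv ℝ f x v

/-- Iterated directional derivatives. -/
def DD {n : ℕ} (v : Fin n → E) (s : Fin n → ℕ) (h : E → ℝ) : E → ℝ :=
  Fin.foldr n (fun i f => (dirD (v i))^[s i] f) h

lemma contDiff_dirD (v : E) (m : ℕ) (f : E → ℝ) (hf : ContDiff ℝ ((m + 1 : ℕ)) f) :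
    ContDiff ℝ m (dirD v f) := by
  have : ContDiff ℝ m (fderiv ℝ f) := hf.fderiv_right (by norm_cast)
  exact this.clm_apply contDiff_const

lemma contDiff_iter (v : E) (k : ℕ) : ∀ (m : ℕ) (f : E → ℝ), ContDiff ℝ ((m + k : ℕ)) f →
    ContDiff ℝ m ((dirD v)^[k] f) := by
  induction k with
  | zero => intro m f hf; simpa using hf
  | succ k ih =>
    intro m f hf
    rw [Function.iterate_succ_apply']
    apply contDiff_dirD
    apply ih
    convert hf using 2
    omega

lemma DD_succ {n : ℕ} (v : Fin (n + 1) → E) (s : Fin (n + 1) → ℕ) (h : E → ℝ) :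
    DD v s h = (dirD (v 0))^[s 0] (DD (fun i => v i.succ) (fun i => s i.succ) h) := by
  unfold DD
  rw [Fin.foldr_succ]

lemma contDiff_DD {n : ℕ} : ∀ (v : Fin n → E) (s : Fin n → ℕ) (m : ℕ) (h : E → ℝ),
    ContDiff ℝ ((m + ∑ i, s i : ℕ)) h → ContDiff ℝ m (DD v s h) := by
  induction n with
  | zero => intro v s m h hh; simpa [DD] using hh
  | succ n ih =>
    intro v s m h hh
    rw [DD_succ]
    apply contDiff_iter
    apply ih
    rw [Fin.sum_univ_succ] at hh
    rwa [add_assoc]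

lemma sum_budget (r S : ℕ) (G : ℕ → ℝ) :
    ∑ k : Fin (r + 1), (if (k : ℕ) + S ≤ r then G k else 0) =
      if S ≤ r then ∑ k ∈ Finset.range (r - S + 1), G k else 0 := by
  rw [Fin.sum_univ_eq_sum_range (fun k => if k + S ≤ r then G k else 0) (r + 1)]
  split_ifs with h
  · rw [← Finset.sum_filter]
    refine Finset.sum_congr ?_ fun _ _ => rfl
    ext k
    simp only [Finset.mem_filter, Finset.mem_range]
    omega
  · refine Finset.sum_eq_zero fun k _ => ?_
    rw [if_neg (by omega)]

theorem taylorN (r : ℕ) (β C δ : ℝ) (hβ : 0 < β) (hC : 0 ≤ C) (hδ : 0 < δ) (S : Set E) (h : E → ℝ)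
    (hh : ContDiff ℝ r h) (n : ℕ) : ∀ (v : Fin n → E), (∀ i, ‖v i‖ ≤ 1) →
    (∀ s : Fin n → ℕ, ∑ i, s i = r → ∀ x ∈ S, ∀ y ∈ S,
      |DD v s h x - DD v s h y| ≤ C * ‖x - y‖ ^ β) →
    ∀ (a : E) (t : Fin n → ℝ), (∀ τ : Fin n → ℝ, (∀ i, τ i ∈ Set.uIcc 0 (t i)) →
      a + ∑ i, τ i • v i ∈ S) → (∀ i, |t i| ≤ δ) →
    |h (a + ∑ i, t i • v i) - ∑ s : Fin n → Fin (r + 1), (if ∑ i, (s i : ℕ) ≤ r then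
      DD v (fun i => (s i : ℕ)) h a * ∏ i, (t i ^ (s i : ℕ) / (Nat.factorial (s i : ℕ) : ℝ)) else 0)|
      ≤ n * (r + 1) ^ n * (C * δ ^ ((r : ℝ) + β)) := by
  induction n with
  | zero =>
    intro v _ _ a t _ _
    simp [DD]
  | succ n ih =>
    intro v hv hH a t hbox ht
    have IH := ih (fun i => v i.succ) (fun i => hv _) (by
      intro s hs x hx y hy
      have := hH (Fin.cons 0 s) (by simp [Fin.sum_univ_succ, hs]) x hx y hy
      rw [DD_succ] at this
      simpa using this) (a + t 0 • v 0) (fun i => t i.succ) (by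
      intro τ hτ
      have := hbox (Fin.cons (t 0) τ) (by
        intro i
        refine Fin.cases ?_ (fun i => ?_) i
        · simp
        · simpa using hτ i)
      rw [Fin.sum_univ_succ] at this
      simpa [add_assoc] using this) (fun i => ht _)
    have e1 : a + ∑ i, t i • v i = a + t 0 • v 0 + ∑ i : Fin n, t i.succ • v i.succ := by
      rw [Fin.sum_univ_succ, add_assoc]
    rw [e1]
    have e2 : ∑ s : Fin (n + 1) → Fin (r + 1), (if ∑ i, (s i : ℕ) ≤ r then
      DD v (fun i => (s i : ℕ)) h a * ∏ i, (t i ^ (s i : ℕ) / (Nat.factorial (s i : ℕ) : ℝ)) else 0)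
      = ∑ s : Fin n → Fin (r + 1), if ∑ i, (s i : ℕ) ≤ r then
        (∑ k ∈ Finset.range (r - ∑ i, (s i : ℕ) + 1),
          (dirD (v 0))^[k] (DD (fun i => v i.succ) (fun i => (s i : ℕ)) h) a *
            (t 0 ^ k / (Nat.factorial k : ℝ))) *
          ∏ i, (t i.succ ^ (s i : ℕ) / (Nat.factorial (s i : ℕ) : ℝ)) else 0 := by
      rw [← Equiv.sum_comp (Fin.consEquiv (fun _ : Fin (n + 1) => Fin (r + 1))),
        Fintype.sum_prod_type_right]
      refine Finset.sum_congr rfl fun s _ => ?_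
      have := sum_budget r (∑ i, (s i : ℕ)) (fun k =>
        ((dirD (v 0))^[k] (DD (fun i => v i.succ) (fun i => (s i : ℕ)) h) a *
            (t 0 ^ k / (Nat.factorial k : ℝ))) *
          ∏ i, (t i.succ ^ (s i : ℕ) / (Nat.factorial (s i : ℕ) : ℝ)))
      rw [← Finset.sum_mul] at this
      rw [← this]
      refine Finset.sum_congr rfl fun k _ => ?_
      simp only [Fin.consEquiv, Equiv.coe_fn_mk, Fin.sum_univ_succ, Fin.prod_univ_succ, DD_succ,
        Fin.cons_zero, Fin.cons_succ, mul_assoc]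
    rw [e2]
    set X := ∑ s : Fin n → Fin (r + 1), (if ∑ i, (s i : ℕ) ≤ r then
      DD (fun i => v i.succ) (fun i => (s i : ℕ)) h (a + t 0 • v 0) *
        ∏ i, (t i.succ ^ (s i : ℕ) / (Nat.factorial (s i : ℕ) : ℝ)) else 0) with hX
    set Y := ∑ s : Fin n → Fin (r + 1), if ∑ i, (s i : ℕ) ≤ r then
        (∑ k ∈ Finset.range (r - ∑ i, (s i : ℕ) + 1),
          (dirD (v 0))^[k] (DD (fun i => v i.succ) (fun i => (s i : ℕ)) h) a *
            (t 0 ^ k / (Nat.factorial k : ℝ))) *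
          ∏ i, (t i.succ ^ (s i : ℕ) / (Nat.factorial (s i : ℕ) : ℝ)) else 0 with hY
    have hB0 : 0 ≤ C * δ ^ ((r : ℝ) + β) := by positivity
    have hXY : |X - Y| ≤ (r + 1) ^ n * (C * δ ^ ((r : ℝ) + β)) := by
      rw [hX, hY, ← Finset.sum_sub_distrib]
      refine (Finset.abs_sum_le_sum_abs _ _).trans ?_
      have : ∀ s ∈ (Finset.univ : Finset (Fin n → Fin (r + 1))),
          |(if ∑ i, (s i : ℕ) ≤ r then
      DD (fun i => v i.succ) (fun i => (s i : ℕ)) h (a + t 0 • v 0) *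
        ∏ i, (t i.succ ^ (s i : ℕ) / (Nat.factorial (s i : ℕ) : ℝ)) else 0) -
          (if ∑ i, (s i : ℕ) ≤ r then
        (∑ k ∈ Finset.range (r - ∑ i, (s i : ℕ) + 1),
          (dirD (v 0))^[k] (DD (fun i => v i.succ) (fun i => (s i : ℕ)) h) a *
            (t 0 ^ k / (Nat.factorial k : ℝ))) *
          ∏ i, (t i.succ ^ (s i : ℕ) / (Nat.factorial (s i : ℕ) : ℝ)) else 0)|
          ≤ C * δ ^ ((r : ℝ) + β) := by
        intro s _
        split_ifs with hs
        · set q := ∑ i, (s i : ℕ) with hq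
          set F := DD (fun i => v i.succ) (fun i => (s i : ℕ)) h with hF
          have hFc : ContDiff ℝ ((r - q : ℕ)) F := by
            apply contDiff_DD
            rw [← hq, Nat.sub_add_cancel hs]
            exact hh
          have T := taylor1 β C hβ hC (r - q) (fun k τ => (dirD (v 0))^[k] F (a + τ • v 0)) (t 0)
            (by
              intro k hk τ
              have h1 : ContDiff ℝ 1 ((dirD (v 0))^[k] F) := by
                have := contDiff_iter (v 0) k 1 F (hFc.of_le (by norm_cast; omega))
                exact_mod_cast this
              have h2 : HasFDerivAt ((dirD (v 0))^[k] F)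
                (fderiv ℝ ((dirD (v 0))^[k] F) (a + τ • v 0)) (a + τ • v 0) :=
                (h1.differentiable one_ne_zero _).hasFDerivAt
              have h3 : HasDerivAt (fun τ : ℝ => a + τ • v 0) (v 0) τ := by
                simpa using ((hasDerivAt_id τ).smul_const (v 0)).const_add a
              have := h2.comp_hasDerivAt τ h3
              rw [Function.iterate_succ_apply']
              exact this)
            (by
              intro τ hτ
              have hin : ∀ σ ∈ Set.uIcc 0 (t 0), a + σ • v 0 ∈ S := by
                intro σ hσ
                have := hbox (Fin.cons σ 0) (by
                  intro i
                  refine Fin.cases ?_ (fun i => ?_) i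
                  · simpa using hσ
                  · simp)
                rw [Fin.sum_univ_succ] at this
                simpa using this
              have := hH (Fin.cons (r - q) (fun i => (s i : ℕ))) (by
                simp only [Fin.sum_univ_succ, Fin.cons_zero, Fin.cons_succ]
                omega) _ (hin τ hτ) _ (hin 0 Set.left_mem_uIcc)
              rw [DD_succ] at this
              simp only [Fin.cons_zero, Fin.cons_succ] at this
              refine this.trans ?_
              refine mul_le_mul_of_nonneg_left ?_ hC
              refine Real.rpow_le_rpow (norm_nonneg _) ?_ hβ.le
              have e : a + τ • v 0 - (a + (0 : ℝ) • v 0) = τ • v 0 := by simp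
              rw [e, norm_smul, Real.norm_eq_abs]
              have := hv 0
              nlinarith [abs_nonneg τ])
          simp only [Function.iterate_zero, id, zero_smul, add_zero] at T
          rw [← sub_mul, abs_mul]
          have hprod : |∏ i, (t i.succ ^ (s i : ℕ) / (Nat.factorial (s i : ℕ) : ℝ))| ≤ δ ^ q := by
            rw [Finset.abs_prod, hq, ← Finset.prod_pow_eq_pow_sum]
            refine Finset.prod_le_prod (fun _ _ => abs_nonneg _) fun i _ => ?_
            rw [abs_div, abs_pow, Nat.abs_cast]
            have h1 : (1 : ℝ) ≤ (Nat.factorial (s i : ℕ) : ℝ) := by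
              exact_mod_cast Nat.factorial_pos _
            refine (div_le_self (by positivity) h1).trans ?_
            exact pow_le_pow_left₀ (abs_nonneg _) (ht _) _
          have hT2 : C * |t 0| ^ (((r - q : ℕ) : ℝ) + β) ≤ C * δ ^ (((r - q : ℕ) : ℝ) + β) := by
            gcongr
            exact ht 0
          refine (mul_le_mul (T.trans hT2) hprod (abs_nonneg _) (by positivity)).trans (le_of_eq ?_)
          rw [mul_assoc, ← Real.rpow_natCast δ q, ← Real.rpow_add hδ]
          congr 2
          rw [Nat.cast_sub hs]
          ring
        · simpa using hB0
      refine (Finset.sum_le_sum this).trans ?_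
      rw [Finset.sum_const, Finset.card_univ, nsmul_eq_mul]
      simp
    have e4 : ∀ z : ℝ, z - Y = (z - X) + (X - Y) := fun z => by ring
    rw [e4]
    refine (abs_add_le _ _).trans ((add_le_add IH hXY).trans ?_)
    rw [← add_mul]
    refine mul_le_mul_of_nonneg_right ?_ hB0
    have : (0 : ℝ) ≤ (r + 1 : ℝ) ^ n := by positivity
    have h0 : (0 : ℝ) ≤ r := Nat.cast_nonneg r
    rw [pow_succ]
    push_cast
    have : (0 : ℝ) ≤ (n + 1) * (r + 1 : ℝ) ^ n * r := by positivity
    nlinarith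

end taylor


/-- The hat function. -/
def hat (y : ℝ) : ℝ := relu (y + 1) - 2 * relu y + relu (y - 1)

lemma hat_bd (y : ℝ) : 0 ≤ hat y ∧ hat y ≤ 1 := by
  unfold hat relu
  rcases le_total 0 y with h | h <;> rcases le_total 0 (y + 1) with h1 | h1 <;>
    rcases le_total 0 (y - 1) with h2 | h2 <;>
    simp only [max_eq_left, max_eq_right, h, h1, h2] <;> constructor <;> linarith

lemma hat_supp (y : ℝ) (hy : hat y ≠ 0) : |y| < 1 := by
  by_contra hc
  push Not at hc
  apply hy
  unfold hat relu
  rcases le_abs.1 hc with h | h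
  · rw [max_eq_right (by linarith), max_eq_right (by linarith), max_eq_right (by linarith)]; ring
  · rw [max_eq_left (by linarith), max_eq_left (by linarith), max_eq_left (by linarith)]; ring

lemma hat_sum (N : ℕ) (t : ℝ) (h0 : 0 ≤ t) (h1 : t ≤ N) :
    ∑ k : Fin (N + 1), hat (t - (k : ℕ)) = 1 := by
  rw [Fin.sum_univ_eq_sum_range (fun k : ℕ => hat (t - (k : ℝ))) (N + 1)]
  have e : ∀ k : ℕ, hat (t - (k : ℝ)) = (fun k : ℕ => relu (t - k + 1) - relu (t - k)) k -
      (fun k : ℕ => relu (t - k + 1) - relu (t - k)) (k + 1) := by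
    intro k
    simp only [hat]
    push_cast
    have e1 : t - ((k : ℝ) + 1) + 1 = t - k := by ring
    have e2 : t - ((k : ℝ) + 1) = t - k - 1 := by ring
    rw [e1, e2]; ring
  rw [Finset.sum_congr rfl fun k _ => e k, Finset.sum_range_sub']
  push_cast
  rw [relu_of_nonneg (by linarith), relu_of_nonneg (by linarith), relu_of_nonpos (by linarith),
    relu_of_nonpos (by linarith)]
  ring

lemma hat_count (N : ℕ) (t : ℝ) (h0 : 0 ≤ t) :
    ∑ k : Fin (N + 1), (if hat (t - (k : ℕ)) ≠ 0 then (1 : ℝ) else 0) ≤ 2 := by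
  rw [Fin.sum_univ_eq_sum_range (fun k : ℕ => if hat (t - (k : ℝ)) ≠ 0 then (1 : ℝ) else 0) (N + 1),
    Finset.sum_boole]
  have : (Finset.range (N + 1)).filter (fun k : ℕ => hat (t - (k : ℝ)) ≠ 0) ⊆ {⌊t⌋₊, ⌊t⌋₊ + 1} := by
    intro k hk
    have := abs_lt.1 (hat_supp _ (Finset.mem_filter.1 hk).2)
    have h2 := Nat.floor_le h0
    have h3 := Nat.lt_floor_add_one t
    have h4 : k < ⌊t⌋₊ + 2 := by
      have : (k : ℝ) < (⌊t⌋₊ + 2 : ℕ) := by push_cast; linarith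
      exact_mod_cast this
    have h5 : ⌊t⌋₊ < k + 1 := by
      have : (⌊t⌋₊ : ℝ) < (k + 1 : ℕ) := by push_cast; linarith
      exact_mod_cast this
    simp only [Finset.mem_insert, Finset.mem_singleton]
    omega
  have := (Finset.card_le_card this).trans Finset.card_le_two
  exact_mod_cast this

/-- Leaf data. -/
structure LeafD where
  W : Fin 4 → ℝ
  B : Fin 4 → ℝ
  C : Fin 4 → ℝ

/-- Hat leaf. -/
def hatL (N n : ℝ) : LeafD := ⟨![N, N, N, 0], ![1 - n, -n, -1 - n, 0], ![1, -2, 1, 0]⟩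
/-- Linear leaf. -/
def linL (y : ℝ) : LeafD := ⟨![1, -1, 0, 0], ![-y, y, 0, 0], ![1, -1, 0, 0]⟩
/-- Constant leaf. -/
def oneL : LeafD := ⟨![0, 0, 0, 0], ![1, 0, 0, 0], ![1, 0, 0, 0]⟩

/-- Leaf selection. -/
def leafOf (N n s a : ℕ) : LeafD :=
  if a = 0 then hatL N n else if a ≤ s then linL (n / N) else oneL

/-- Leaf value. -/
def leafV (N n s a : ℕ) (x : ℝ) : ℝ :=
  if a = 0 then hat (N * x - n) else if a ≤ s then x - n / N else 1

lemma leafE_one {d : ℕ} (i : Fin d) (x : Fin d → ℝ) : leafE i oneL.W oneL.B oneL.C x = 1 := by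
  simp [leafE, oneL, Fin.sum_univ_four, relu]

lemma leafE_leafOf {d : ℕ} (N n s a : ℕ) (i : Fin d) (x : Fin d → ℝ) :
    leafE i (leafOf N n s a).W (leafOf N n s a).B (leafOf N n s a).C x = leafV N n s a (x i) := by
  unfold leafOf leafV
  split_ifs
  · simp only [leafE, hatL, Fin.sum_univ_four, hat]
    simp only [Matrix.cons_val_zero, Matrix.cons_val_one, Matrix.cons_val]
    have e1 : (N : ℝ) * x i + (1 - n) = N * x i - n + 1 := by ring
    have e2 : (N : ℝ) * x i + (-1 - n) = N * x i - n - 1 := by ring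
    rw [e1, e2, ← sub_eq_add_neg]
    ring
  · simp only [leafE, linL, Fin.sum_univ_four]
    simp only [Matrix.cons_val_zero, Matrix.cons_val_one, Matrix.cons_val]
    have e1 : -1 * x i + (n : ℝ) / N = -(x i - n / N) := by ring
    rw [e1, one_mul, one_mul, ← sub_eq_add_neg]
    have : ∀ z : ℝ, relu z - relu (-z) = z := by
      intro z
      unfold relu
      rcases le_total 0 z with h | h
      · rw [max_eq_right h, max_eq_left (by linarith)]; ring
      · rw [max_eq_left h, max_eq_right (by linarith)]; ring
    have := this (x i - n / N)
    linarith
  · exact leafE_one i x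

lemma leafV_abs (N n s a : ℕ) (hN : 1 ≤ N) (hn : n ≤ N) (x : ℝ) (h0 : 0 ≤ x) (h1 : x ≤ 1) :
    |leafV N n s a x| ≤ 1 := by
  have hN' : (0 : ℝ) < N := by exact_mod_cast hN
  have h2 : (0 : ℝ) ≤ n / N := by positivity
  have h3 : (n : ℝ) / N ≤ 1 := by rw [div_le_one hN']; exact_mod_cast hn
  unfold leafV
  split_ifs
  · have := hat_bd (N * x - n)
    rw [abs_le]; constructor <;> linarith
  · rw [abs_le]; constructor <;> linarith
  · simp

lemma oneL_bd (N : ℝ) (hN : 1 ≤ N) (q : Fin 4) :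
    |oneL.W q| ≤ N ∧ |oneL.B q| ≤ 2 * N ∧ |oneL.C q| ≤ 2 := by
  fin_cases q <;> simp [oneL] <;> (try constructor) <;> linarith

lemma leafOf_bd (N n s a : ℕ) (hN : 1 ≤ N) (hn : n ≤ N) (q : Fin 4) :
    |(leafOf N n s a).W q| ≤ N ∧ |(leafOf N n s a).B q| ≤ 2 * N ∧ |(leafOf N n s a).C q| ≤ 2 := by
  have hN1 : (1 : ℝ) ≤ N := by exact_mod_cast hN
  have hN' : (0 : ℝ) < N := by exact_mod_cast hN
  have hn0 : (0 : ℝ) ≤ n := Nat.cast_nonneg n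
  have hnN : (n : ℝ) ≤ N := by exact_mod_cast hn
  have h2 : (0 : ℝ) ≤ n / N := by positivity
  have h3 : (n : ℝ) / N ≤ 1 := by rw [div_le_one hN']; exact_mod_cast hn
  unfold leafOf
  split_ifs
  · fin_cases q <;> simp only [hatL, Fin.zero_eta, Fin.mk_one, Fin.reduceFinMk,
      Matrix.cons_val_zero, Matrix.cons_val_one, Matrix.cons_val] <;>
      refine ⟨abs_le.2 ⟨?_, ?_⟩, abs_le.2 ⟨?_, ?_⟩, abs_le.2 ⟨?_, ?_⟩⟩ <;> linarith
  · fin_cases q <;> simp only [linL, Fin.zero_eta, Fin.mk_one, Fin.reduceFinMk,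
      Matrix.cons_val_zero, Matrix.cons_val_one, Matrix.cons_val] <;>
      refine ⟨abs_le.2 ⟨?_, ?_⟩, abs_le.2 ⟨?_, ?_⟩, abs_le.2 ⟨?_, ?_⟩⟩ <;> linarith
  · exact oneL_bd N hN1 q

lemma leafV_prod (N n r : ℕ) (s : Fin (r + 1)) (x : ℝ) :
    ∏ a : Fin (r + 1), leafV N n s a x = hat (N * x - n) * (x - n / N) ^ (s : ℕ) := by
  rw [Fin.prod_univ_succ]
  congr 1
  have : ∀ a : Fin r, leafV N n s (a.succ : Fin (r + 1)) x =
      if (a : ℕ) < s then x - n / N else 1 := by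
    intro a
    simp [leafV]
  rw [Finset.prod_congr rfl fun a _ => this a,
    Fin.prod_univ_eq_prod_range (fun a : ℕ => if a < (s : ℕ) then x - (n : ℝ) / N else 1) r,
    ← Finset.prod_filter, Finset.prod_const]
  congr 1
  have e : (Finset.range r).filter (fun a => a < (s : ℕ)) = Finset.range s := by
    ext a
    have := s.2
    simp only [Finset.mem_filter, Finset.mem_range]
    omega
  rw [e, Finset.card_range]

lemma prod_leaf (Q R : ℕ) [NeZero Q] (hRQ : R ≤ Q) (f : Fin R → ℝ) :
    ∏ i ∈ Finset.range Q, (if h : ((i : ℕ) : ZMod Q).val < R then f ⟨_, h⟩ else 1) = ∏ i, f i := by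
  let F : ℕ → ℝ := fun i => if h : i < R then f ⟨i, h⟩ else 1
  have e1 : ∀ i ∈ Finset.range Q, (if h : ((i : ℕ) : ZMod Q).val < R then f ⟨_, h⟩ else 1) = F i := by
    intro i hi
    change F _ = F i
    rw [ZMod.val_cast_of_lt (Finset.mem_range.1 hi)]
  rw [Finset.prod_congr rfl e1]
  have e2 : ∏ i, f i = ∏ i ∈ Finset.range R, F i := by
    rw [Finset.prod_range]
    refine Finset.prod_congr rfl fun i _ => ?_
    simp [F]
  rw [e2]
  symm
  refine Finset.prod_subset (Finset.range_subset_range.2 hRQ) ?_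
  intro i _ hi
  simp only [Finset.mem_range] at hi
  simp [F, hi]


lemma holder_taylor (d r : ℕ) (β : ℝ) (hβ : 0 < β) (h : (Fin d → ℝ) → ℝ) (hd : 1 ≤ d)
    (hh : HolderUnitBall r β (cube d 0 1) h) :
    (∀ s ∈ multiIdxLe d r, ∀ a ∈ cube d 0 1, |mderiv (fun i => (s i : ℕ)) h a| ≤ 1) ∧
    ∀ (a x : Fin d → ℝ), a ∈ cube d 0 1 → x ∈ cube d 0 1 → ∀ δ : ℝ, 0 < δ →
      (∀ i, |x i - a i| ≤ δ) →
      |h x - ∑ s : Fin d → Fin (r + 1), (if ∑ i, (s i : ℕ) ≤ r then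
        mderiv (fun i => (s i : ℕ)) h a *
          ∏ i, ((x i - a i) ^ (s i : ℕ) / (Nat.factorial (s i : ℕ) : ℝ)) else 0)|
        ≤ d * (r + 1) ^ d * δ ^ ((r : ℝ) + β) := by
  obtain ⟨hc, M, C, hM, hC, hsum⟩ := hh
  have z0 : (0 : Fin d → ℝ) ∈ cube d 0 1 := fun i => by simp
  have z1 : (1 : Fin d → ℝ) ∈ cube d 0 1 := fun i => by simp
  have hM0 : ∀ s ∈ multiIdxLe d r, 0 ≤ M s := fun s hs => (abs_nonneg _).trans (hM s hs 0 z0)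
  have hne : Nonempty (Fin d) := ⟨⟨0, hd⟩⟩
  have hC0 : 0 ≤ C := by
    have := hC (Function.update 0 ⟨0, hd⟩ (Fin.last r)) (by
      rw [Finset.sum_eq_single (⟨0, hd⟩ : Fin d)]
      · simp
      · intro b _ hb
        simp [Function.update_of_ne hb]
      · simp) 1 z1 0 z0
    have h1 := (abs_nonneg _).trans this
    simpa using h1
  have hM1 : ∀ s ∈ multiIdxLe d r, M s ≤ 1 := fun s hs => by
    have := Finset.single_le_sum hM0 hs
    linarith
  have hC1 : C ≤ 1 := by
    have := Finset.sum_nonneg hM0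
    linarith
  refine ⟨fun s hs a ha => (hM s hs a ha).trans (hM1 s hs), ?_⟩
  intro a x ha hx δ hδ hxa
  have hsing : ∀ τ : Fin d → ℝ, ∑ i, τ i • (Pi.single i (1 : ℝ) : Fin d → ℝ) = τ := by
    intro τ
    funext k
    simp [Finset.sum_apply, Pi.single_apply]
  have T := taylorN r β C δ hβ hC0 hδ (cube d 0 1) h hc d (fun i => Pi.single i (1 : ℝ))
    (fun i => by simp [Pi.norm_single]) (by
      intro s hs x hx y hy
      have hle : ∀ i, s i < r + 1 := fun i => by
        have := Finset.single_le_sum (f := s) (fun _ _ => Nat.zero_le _) (Finset.mem_univ i)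
        omega
      exact hC (fun i => ⟨s i, hle i⟩) hs x hx y hy) a (fun i => x i - a i) (by
      intro τ hτ
      rw [hsing τ]
      intro i
      have h1 := hτ i
      have h2 := ha i
      have h3 := hx i
      simp only [Set.mem_Icc] at h2 h3 ⊢
      rw [Pi.add_apply]
      rcases Set.mem_uIcc.1 h1 with h | h <;> constructor <;> linarith [h.1, h.2]) hxa
  rw [hsing (fun i => x i - a i)] at T
  have e : a + (fun i => x i - a i) = x := by funext i; simp
  rw [e] at T
  refine T.trans ?_
  refine mul_le_mul_of_nonneg_left ?_ (by positivity)
  have : 0 ≤ δ ^ ((r : ℝ) + β) := by positivity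
  nlinarith

set_option maxHeartbeats 2000000 in
theorem approx_grid (d r : ℕ) (hd : 1 ≤ d) (β : ℝ) (hβ : 0 < β) (D' : ℕ)
    (hD : d * (r + 1) ≤ 2 ^ D') (N M : ℕ) (hN : 1 ≤ N) (hM : 0 < M) (h : (Fin d → ℝ) → ℝ)
    (hh : HolderUnitBall r β (cube d 0 1) h) (K : ℝ) (W : ℕ)
    (hW : (N + 1) ^ d * (r + 1) ^ d * 2 ^ D' * 4 * M ≤ W)
    (hK : (N : ℝ) * Real.sqrt (300 * ((N + 1) ^ d * (r + 1) ^ d) * (2 ^ D') ^ 2) ^ (D' + 2) ≤ K) :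
    ∃ φ ∈ NNclass d 1 W (D' + 1) K, ∀ x ∈ cube d 0 1,
      |h x - φ x 0| ≤ d * (r + 1) ^ d * (1 / (N : ℝ)) ^ ((r : ℝ) + β)
        + 2 ^ d * (r + 1) ^ d * (2 ^ D' * (1 / (M : ℝ) ^ 2)) := by
  classical
  obtain ⟨hder, htay⟩ := holder_taylor d r β hβ h hd hh
  have hN1 : (1 : ℝ) ≤ N := by exact_mod_cast hN
  have hN0 : (0 : ℝ) < N := by linarith
  have hQ : NeZero (2 ^ D') := ⟨by positivity⟩
  let gp : (Fin d → Fin (N + 1)) → Fin d → ℝ := fun n i => ((n i : ℕ) : ℝ) / N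
  have hgp : ∀ n, gp n ∈ cube d 0 1 := by
    intro n i
    have h1 : ((n i : ℕ) : ℝ) ≤ N := by exact_mod_cast Nat.lt_succ_iff.1 (n i).2
    exact ⟨by positivity, (div_le_one hN0).2 h1⟩
  let cf : (Fin d → Fin (N + 1)) × (Fin d → Fin (r + 1)) → ℝ := fun p =>
    if ∑ i, (p.2 i : ℕ) ≤ r then mderiv (fun i => (p.2 i : ℕ)) h (gp p.1) *
      ∏ i, (1 / (Nat.factorial (p.2 i : ℕ) : ℝ)) else 0
  let ix : ZMod (2 ^ D') → Option (Fin d × Fin (r + 1)) := fun j =>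
    if hj : j.val < d * (r + 1) then some (finProdFinEquiv.symm ⟨j.val, hj⟩) else none
  let lf : (Fin d → Fin (N + 1)) × (Fin d → Fin (r + 1)) → ZMod (2 ^ D') → LeafD := fun p j =>
    match ix j with
    | some y => leafOf N (p.1 y.1) (p.2 y.1) y.2
    | none => oneL
  let li : (Fin d → Fin (N + 1)) × (Fin d → Fin (r + 1)) → ZMod (2 ^ D') → Fin d := fun p j =>
    match ix j with
    | some y => y.1
    | none => ⟨0, hd⟩
  have hlf : ∀ p j q, |(lf p j).W q| ≤ N ∧ |(lf p j).B q| ≤ 2 * N ∧ |(lf p j).C q| ≤ 2 := by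
    intro p j q
    simp only [lf]
    cases ix j with
    | none => exact oneL_bd N hN1 q
    | some y => exact leafOf_bd N _ _ _ hN (Nat.lt_succ_iff.1 (p.1 y.1).2) q
  have hcf : ∀ p, |cf p| ≤ 1 := by
    intro p
    simp only [cf]
    split_ifs with hp
    · rw [abs_mul]
      have h1 := hder p.2 (by simp [multiIdxLe, hp]) _ (hgp p.1)
      have h2 : |∏ i, (1 / (Nat.factorial (p.2 i : ℕ) : ℝ))| ≤ 1 := by
        rw [Finset.abs_prod]
        refine Finset.prod_le_one (fun _ _ => abs_nonneg _) fun i _ => ?_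
        rw [abs_of_nonneg (by positivity)]
        have : (1 : ℝ) ≤ (Nat.factorial (p.2 i : ℕ) : ℝ) := by exact_mod_cast Nat.factorial_pos _
        exact (div_le_one (by linarith)).2 this
      exact mul_le_one₀ h1 (abs_nonneg _) h2
    · simp
  have hcardP : Fintype.card ((Fin d → Fin (N + 1)) × (Fin d → Fin (r + 1))) =
      (N + 1) ^ d * (r + 1) ^ d := by simp
  have hcardJ : Fintype.card (ZMod (2 ^ D')) = 2 ^ D' := ZMod.card _
  have net := tree_net M li (fun p j => (lf p j).W) (fun p j => (lf p j).B)
    (fun p j => (lf p j).C) cf hM D' W K N hN1 (fun p j q => (hlf p j q).1)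
    (fun p j q => (hlf p j q).2.1) (fun p j q => (hlf p j q).2.2) hcf
    (by rw [hcardP, hcardJ]; exact hW)
    (by rw [hcardP, hcardJ]; push_cast; exact hK)
  refine ⟨_, net, ?_⟩
  intro x hx
  let hv : (Fin d → Fin (N + 1)) → Fin d → ℝ := fun n i => hat (N * x i - (n i : ℕ))
  let bump : (Fin d → Fin (N + 1)) → ℝ := fun n => ∏ i, hv n i
  let mono : (Fin d → Fin (N + 1)) × (Fin d → Fin (r + 1)) → ℝ := fun p =>
    ∏ i, (x i - gp p.1 i) ^ (p.2 i : ℕ)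
  let g : (Fin d → Fin (N + 1)) × (Fin d → Fin (r + 1)) → ZMod (2 ^ D') → ℝ := fun p j =>
    if hj : j.val < d * (r + 1) then
      (fun k : Fin (d * (r + 1)) => leafV N (p.1 (finProdFinEquiv.symm k).1)
        (p.2 (finProdFinEquiv.symm k).1) (finProdFinEquiv.symm k).2
        (x (finProdFinEquiv.symm k).1)) ⟨j.val, hj⟩ else 1
  have hg : ∀ p, (fun j => leafE (li p j) (lf p j).W (lf p j).B (lf p j).C x) = g p := by
    intro p
    funext j
    simp only [li, lf, g, ix]
    split_ifs with hj
    · exact leafE_leafOf _ _ _ _ _ _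
    · exact leafE_one _ _
  have hg1 : ∀ p j, |g p j| ≤ 1 := by
    intro p j
    simp only [g]
    split_ifs with hj
    · exact leafV_abs N _ _ _ hN (Nat.lt_succ_iff.1 (p.1 _).2) _ (hx _).1 (hx _).2
    · simp
  have hgprod : ∀ p, ∏ i ∈ Finset.range (2 ^ D'), g p (0 + ((i : ℕ) : ZMod (2 ^ D'))) =
      bump p.1 * mono p := by
    intro p
    simp only [zero_add, g]
    rw [prod_leaf (2 ^ D') (d * (r + 1)) hD (fun k : Fin (d * (r + 1)) =>
        leafV N (p.1 (finProdFinEquiv.symm k).1)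
        (p.2 (finProdFinEquiv.symm k).1) (finProdFinEquiv.symm k).2
        (x (finProdFinEquiv.symm k).1)),
      Equiv.prod_comp finProdFinEquiv.symm (fun y : Fin d × Fin (r + 1) =>
        leafV N (p.1 y.1) (p.2 y.1) y.2 (x y.1)), Fintype.prod_prod_type, ← Finset.prod_mul_distrib]
    refine Finset.prod_congr rfl fun i _ => ?_
    have hlp := leafV_prod N (p.1 i : ℕ) r (p.2 i) (x i)
    rw [hlp]
  have hε0 : (0 : ℝ) ≤ 2 ^ D' * (1 / (M : ℝ) ^ 2) := by positivity
  have hval : ∀ p, |bump p.1 * mono p - valA M (g p) D' 0| ≤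
      (∏ i, (if hv p.1 i ≠ 0 then (1 : ℝ) else 0)) * (2 ^ D' * (1 / (M : ℝ) ^ 2)) := by
    intro p
    by_cases hz : ∃ i, hv p.1 i = 0
    · obtain ⟨i, hi⟩ := hz
      have hb : bump p.1 = 0 := Finset.prod_eq_zero (Finset.mem_univ i) hi
      have hp0 := hgprod p
      rw [hb, zero_mul, Finset.prod_eq_zero_iff] at hp0
      obtain ⟨k, hk, hk0⟩ := hp0
      rw [valA_zero M (g p) D' 0 ⟨k, Finset.mem_range.1 hk, hk0⟩, hb]
      simp only [zero_mul, sub_zero, abs_zero]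
      refine mul_nonneg (Finset.prod_nonneg fun i _ => ?_) hε0
      split_ifs <;> norm_num
    · push Not at hz
      rw [Finset.prod_congr rfl fun i _ => if_pos (hz i), Finset.prod_const_one, one_mul,
        abs_sub_comm, ← hgprod p]
      refine (valA_approx M hM (g p) (hg1 p) D' 0).trans ?_
      refine mul_le_mul_of_nonneg_right (by linarith) (by positivity)
  have hNx : ∀ i, 0 ≤ (N : ℝ) * x i ∧ (N : ℝ) * x i ≤ N := fun i => by
    have := hx i
    exact ⟨mul_nonneg hN0.le this.1, by nlinarith [this.2]⟩
  have hpart : ∑ n, bump n = 1 := by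
    have := Finset.prod_univ_sum (fun _ : Fin d => (Finset.univ : Finset (Fin (N + 1))))
      (fun i k => hat (N * x i - (k : ℕ)))
    rw [Fintype.piFinset_univ] at this
    simp only [bump, hv]
    rw [← this]
    exact Finset.prod_eq_one fun i _ => hat_sum N _ (hNx i).1 (hNx i).2
  have hcount : ∑ n : Fin d → Fin (N + 1), ∏ i, (if hv n i ≠ 0 then (1 : ℝ) else 0) ≤ 2 ^ d := by
    have := Finset.prod_univ_sum (fun _ : Fin d => (Finset.univ : Finset (Fin (N + 1))))
      (fun i k => if hat (N * x i - (k : ℕ)) ≠ 0 then (1 : ℝ) else 0)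
    rw [Fintype.piFinset_univ] at this
    simp only [hv]
    rw [← this]
    calc _ ≤ ∏ _i : Fin d, (2 : ℝ) := by
          refine Finset.prod_le_prod (fun i _ => Finset.sum_nonneg fun k _ => ?_)
            fun i _ => hat_count N _ (hNx i).1
          split_ifs <;> norm_num
      _ = 2 ^ d := by simp
  have hbump0 : ∀ n, 0 ≤ bump n := fun n => Finset.prod_nonneg fun i _ => (hat_bd _).1
  set E1 : ℝ := d * (r + 1) ^ d * (1 / (N : ℝ)) ^ ((r : ℝ) + β) with hE1
  -- Taylor part
  let Tn : (Fin d → Fin (N + 1)) → ℝ := fun n => ∑ s, cf (n, s) * mono (n, s)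
  have hT : ∀ n, bump n * |h x - Tn n| ≤ bump n * E1 := by
    intro n
    by_cases hz : bump n = 0
    · simp [hz]
    · refine mul_le_mul_of_nonneg_left ?_ (hbump0 n)
      have hclose : ∀ i, |x i - gp n i| ≤ 1 / (N : ℝ) := by
        intro i
        have h1 : hv n i ≠ 0 := fun h0 => hz (Finset.prod_eq_zero (Finset.mem_univ i) h0)
        have h2 := (hat_supp _ h1).le
        have e : (N : ℝ) * x i - (n i : ℕ) = N * (x i - gp n i) := by
          simp only [gp]; field_simp
        rw [e, abs_mul, abs_of_pos hN0] at h2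
        rw [le_div_iff₀ hN0]; linarith
      have := htay (gp n) x (hgp n) hx (1 / (N : ℝ)) (by positivity) hclose
      refine le_trans (le_of_eq ?_) this
      congr 2
      refine Finset.sum_congr rfl fun s _ => ?_
      simp only [cf, mono]
      split_ifs
      · rw [mul_assoc, ← Finset.prod_mul_distrib]
        congr 1
        refine Finset.prod_congr rfl fun i _ => ?_
        ring
      · ring
  have hA : |h x - ∑ n, bump n * Tn n| ≤ E1 := by
    have e : h x - ∑ n, bump n * Tn n = ∑ n, bump n * (h x - Tn n) := by
      simp only [mul_sub, Finset.sum_sub_distrib]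
      rw [← Finset.sum_mul, hpart, one_mul]
    rw [e]
    refine (Finset.abs_sum_le_sum_abs _ _).trans ?_
    have : ∀ n ∈ Finset.univ, |bump n * (h x - Tn n)| ≤ bump n * E1 := fun n _ => by
      rw [abs_mul, abs_of_nonneg (hbump0 n)]; exact hT n
    refine (Finset.sum_le_sum this).trans ?_
    rw [← Finset.sum_mul, hpart, one_mul]
  have hB : |∑ n, bump n * Tn n - ∑ p, cf p * valA M (g p) D' 0| ≤
      2 ^ d * (r + 1) ^ d * (2 ^ D' * (1 / (M : ℝ) ^ 2)) := by
    have e : ∑ n, bump n * Tn n - ∑ p, cf p * valA M (g p) D' 0 =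
        ∑ p, cf p * (bump p.1 * mono p - valA M (g p) D' 0) := by
      simp only [mul_sub, Finset.sum_sub_distrib]
      congr 1
      rw [Fintype.sum_prod_type]
      refine Finset.sum_congr rfl fun n _ => ?_
      simp only [Tn]
      rw [Finset.mul_sum]
      refine Finset.sum_congr rfl fun s _ => ?_
      ring
    rw [e]
    refine (Finset.abs_sum_le_sum_abs _ _).trans ?_
    have : ∀ p ∈ Finset.univ, |cf p * (bump p.1 * mono p - valA M (g p) D' 0)| ≤
        (∏ i, (if hv p.1 i ≠ 0 then (1 : ℝ) else 0)) * (2 ^ D' * (1 / (M : ℝ) ^ 2)) := by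
      intro p _
      rw [abs_mul]
      refine le_trans ?_ (hval p)
      exact mul_le_of_le_one_left (abs_nonneg _) (hcf p)
    refine (Finset.sum_le_sum this).trans ?_
    let cnt : (Fin d → Fin (N + 1)) → ℝ := fun n => ∏ i, (if hv n i ≠ 0 then (1 : ℝ) else 0)
    change ∑ p : (Fin d → Fin (N + 1)) × (Fin d → Fin (r + 1)),
      cnt p.1 * (2 ^ D' * (1 / (M : ℝ) ^ 2)) ≤ _
    change ∑ n : Fin d → Fin (N + 1), cnt n ≤ 2 ^ d at hcount
    rw [Fintype.sum_prod_type]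
    simp only [Finset.sum_const, Finset.card_univ, Fintype.card_pi, Fintype.card_fin,
      Finset.prod_const, nsmul_eq_mul]
    rw [← Finset.mul_sum, ← Finset.sum_mul]
    push_cast
    have h1 := mul_le_mul_of_nonneg_right hcount
      (mul_nonneg (by positivity : (0 : ℝ) ≤ (r + 1) ^ d) hε0)
    linarith
  have hfin : (∑ p, cf p * valA M (fun j => leafE (li p j) (lf p j).W (lf p j).B (lf p j).C x) D' 0)
      = ∑ p, cf p * valA M (g p) D' 0 := by
    refine Finset.sum_congr rfl fun p _ => ?_
    rw [hg p]
  change |h x - ∑ p, cf p * valA M (fun j => leafE (li p j) (lf p j).W (lf p j).B (lf p j).C x) D' 0| ≤ _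
  rw [hfin]
  have e3 : h x - ∑ p, cf p * valA M (g p) D' 0 = (h x - ∑ n, bump n * Tn n) +
    (∑ n, bump n * Tn n - ∑ p, cf p * valA M (g p) D' 0) := by ring
  rw [e3]
  exact (abs_add_le _ _).trans (add_le_add hA hB)


lemma foldr_const {γ : Type*} (n : ℕ) (z : γ) : Fin.foldr n (fun _ f => f) z = z := by
  induction n with
  | zero => simp
  | succ n ih => rw [Fin.foldr_succ]; exact ih

lemma zero_mem_NN (d W D' : ℕ) (K : ℝ) (hK : 0 ≤ K) :
    (fun (_ : Fin d → ℝ) (_ : Fin 1) => (0 : ℝ)) ∈ NNclass d 1 W (D' + 1) K := by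
  have := mkNet (d := d) (D' := D') (W := W) (T := Fin 0) (fun _ _ => 0) (fun _ => 0)
    (fun _ _ _ => 0) (fun _ _ => 0) (fun _ => 0) K (by simp) (by simpa using hK)
  simpa using this

lemma holder_abs_le_one (d r : ℕ) (β : ℝ) (hβ : 0 < β) (h : (Fin d → ℝ) → ℝ) (hd : 1 ≤ d)
    (hh : HolderUnitBall r β (cube d 0 1) h) (x : Fin d → ℝ) (hx : x ∈ cube d 0 1) :
    |h x| ≤ 1 := by
  have := (holder_taylor d r β hβ h hd hh).1 (fun _ => 0) (by simp [multiIdxLe]) x hx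
  have e : mderiv (fun _ : Fin d => 0) h = h := by
    unfold mderiv
    simp only [Function.iterate_zero, id]
    exact foldr_const d h
  simpa [e] using this

/-- Constant controlling the norm budget. -/
def C0 (d r D' : ℕ) : ℝ := (300 * (2 ^ d * (r + 1) ^ d) * (2 ^ D') ^ 2) ^ (D' + 2)

lemma C0_ge (d r D' : ℕ) : 1 ≤ C0 d r D' := by
  unfold C0
  apply one_le_pow₀
  have h1 : (1 : ℝ) ≤ 2 ^ d := one_le_pow₀ (by norm_num)
  have h2 : (1 : ℝ) ≤ (r + 1) ^ d := one_le_pow₀ (by linarith [Nat.cast_nonneg (α := ℝ) r])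
  have h3 : (1 : ℝ) ≤ (2 ^ D') ^ 2 := one_le_pow₀ (one_le_pow₀ (by norm_num))
  have h4 := one_le_mul_of_one_le_of_one_le h1 h2
  have h5 := one_le_mul_of_one_le_of_one_le h4 h3
  nlinarith

lemma norm_budget (d r D' N : ℕ) (hN : 1 ≤ N) (K : ℝ) (hK : 0 ≤ K)
    (h : C0 d r D' * (N : ℝ) ^ (d * (D' + 2) + 2) ≤ K ^ 2) :
    (N : ℝ) * Real.sqrt (300 * ((N + 1) ^ d * (r + 1) ^ d) * (2 ^ D') ^ 2) ^ (D' + 2) ≤ K := by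
  have hN1 : (1 : ℝ) ≤ N := by exact_mod_cast hN
  refine (pow_le_pow_iff_left₀ (by positivity) hK two_ne_zero).1 ?_
  refine le_trans ?_ h
  rw [mul_pow, ← pow_mul, mul_comm (D' + 2) 2, pow_mul, Real.sq_sqrt (by positivity)]
  have h1 : ((N : ℝ) + 1) ^ d ≤ 2 ^ d * N ^ d := by
    rw [← mul_pow]
    exact pow_le_pow_left₀ (by positivity) (by linarith) d
  have h2 : 300 * (((N : ℝ) + 1) ^ d * (r + 1) ^ d) * (2 ^ D') ^ 2 ≤
      (300 * (2 ^ d * (r + 1) ^ d) * (2 ^ D') ^ 2) * N ^ d := by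
    calc _ ≤ 300 * ((2 ^ d * (N : ℝ) ^ d) * (r + 1) ^ d) * (2 ^ D') ^ 2 := by gcongr
      _ = _ := by ring
  calc _ ≤ (N : ℝ) ^ 2 * ((300 * (2 ^ d * (r + 1) ^ d) * (2 ^ D') ^ 2) * N ^ d) ^ (D' + 2) := by
        gcongr
    _ = _ := by unfold C0; rw [mul_pow, ← pow_mul, pow_add]; ring

theorem final_aux (d r : ℕ) (hd : 1 ≤ d) (β : ℝ) (hβ : 0 < β) (D' : ℕ)
    (hD : d * (r + 1) ≤ 2 ^ D') (K y : ℝ) (hK : 1 ≤ K) (hy : 1 ≤ y)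
    (hyK : y ^ (d * (D' + 2) + 2) = K ^ 2) (h : (Fin d → ℝ) → ℝ)
    (hh : HolderUnitBall r β (cube d 0 1) h) (W : ℕ)
    (hW : (2 ^ d * (r + 1) ^ d * 2 ^ D' * 8) * y ^ ((d : ℝ) + (r + β) / 2) ≤ (W : ℝ)) :
    ∃ φ ∈ NNclass d 1 W (D' + 1) K, ∀ x ∈ cube d 0 1,
      |h x - φ x 0| ≤ (d * (r + 1) ^ d * (2 * C0 d r D') ^ ((r : ℝ) + β)
        + 2 ^ d * (r + 1) ^ d * 2 ^ D' + C0 d r D' ^ ((r : ℝ) + β)) * y ^ (-((r : ℝ) + β)) := by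
  have hC := C0_ge d r D'
  set c0 := C0 d r D' with hc0
  set α : ℝ := (r : ℝ) + β with hα
  have hα0 : 0 < α := by positivity
  have hy0 : 0 < y := by linarith
  have hC00 : 0 < c0 := by linarith
  have hya : 0 < y ^ α := by positivity
  have hneg : y ^ (-α) = (y ^ α)⁻¹ := Real.rpow_neg hy0.le α
  by_cases hcase : y < c0
  · refine ⟨_, zero_mem_NN d W D' K (by linarith), fun x hx => ?_⟩
    have h1 := holder_abs_le_one d r β hβ h hd hh x hx
    simp only [sub_zero]
    refine h1.trans ?_
    have h2 : (1 : ℝ) ≤ c0 ^ α * y ^ (-α) := by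
      rw [hneg, ← div_eq_mul_inv, one_le_div hya]
      exact Real.rpow_le_rpow hy0.le hcase.le hα0.le
    have h3 : 0 ≤ (d * (r + 1) ^ d * (2 * c0) ^ α + 2 ^ d * (r + 1) ^ d * 2 ^ D') * y ^ (-α) := by
      positivity
    nlinarith
  · push Not at hcase
    set N : ℕ := ⌊y / c0⌋₊ with hNdef
    set M : ℕ := ⌈y ^ (α / 2)⌉₊ with hMdef
    have hq : 1 ≤ y / c0 := (one_le_div hC00).2 hcase
    have hN : 1 ≤ N := Nat.one_le_floor_iff _ |>.2 hq
    have hN1 : (1 : ℝ) ≤ N := by exact_mod_cast hN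
    have hNle : (N : ℝ) ≤ y / c0 := Nat.floor_le (by positivity)
    have hNlt : y / c0 < N + 1 := Nat.lt_floor_add_one _
    have hNy : (N : ℝ) ≤ y := hNle.trans (div_le_self hy0.le hC)
    have hya2 : 1 ≤ y ^ (α / 2) := Real.one_le_rpow hy (by positivity)
    have hMge : y ^ (α / 2) ≤ M := Nat.le_ceil _
    have hMle : (M : ℝ) ≤ 2 * y ^ (α / 2) := by
      have := (Nat.ceil_lt_add_one (by positivity : 0 ≤ y ^ (α / 2))).le
      linarith
    have hM : 0 < M := by
      have : (0 : ℝ) < M := by linarith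
      exact_mod_cast this
    have hsq : (y ^ (α / 2)) ^ 2 = y ^ α := by
      rw [← Real.rpow_natCast, ← Real.rpow_mul hy0.le]; congr 1; push_cast; ring
    obtain ⟨φ, hφ, hφx⟩ := approx_grid d r hd β hβ D' hD N M hN hM h hh K W (by
      have e : y ^ ((d : ℝ) + α / 2) = y ^ d * y ^ (α / 2) := by
        rw [Real.rpow_add hy0, Real.rpow_natCast]
      rw [e] at hW
      have h1 : ((N : ℝ) + 1) ^ d ≤ 2 ^ d * y ^ d := by
        rw [← mul_pow]
        exact pow_le_pow_left₀ (by positivity) (by linarith) d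
      have : ((N : ℝ) + 1) ^ d * (r + 1) ^ d * 2 ^ D' * 4 * M ≤ W := by
        calc _ ≤ (2 ^ d * y ^ d) * ((r : ℝ) + 1) ^ d * 2 ^ D' * 4 * (2 * y ^ (α / 2)) := by gcongr
          _ = (2 ^ d * (r + 1) ^ d * 2 ^ D' * 8) * (y ^ d * y ^ (α / 2)) := by ring
          _ ≤ W := hW
      exact_mod_cast this) (norm_budget d r D' N hN K (by linarith) (by
        rw [← hyK, ← hc0]
        have h1 : (N : ℝ) ^ (d * (D' + 2) + 2) ≤ (y / c0) ^ (d * (D' + 2) + 2) :=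
          pow_le_pow_left₀ (by positivity) hNle _
        have h2 : c0 ≤ c0 ^ (d * (D' + 2) + 2) := le_self_pow₀ hC (by omega)
        calc _ ≤ c0 * (y / c0) ^ (d * (D' + 2) + 2) := by gcongr
          _ ≤ c0 ^ (d * (D' + 2) + 2) * (y / c0) ^ (d * (D' + 2) + 2) := by gcongr
          _ = _ := by rw [← mul_pow, mul_div_cancel₀ _ hC00.ne']))
    refine ⟨φ, hφ, fun x hx => (hφx x hx).trans ?_⟩
    have h1 : (1 / (N : ℝ)) ^ α ≤ (2 * c0) ^ α * y ^ (-α) := by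
      rw [hneg, ← Real.inv_rpow hy0.le, ← Real.mul_rpow (by positivity) (by positivity)]
      refine Real.rpow_le_rpow (by positivity) ?_ hα0.le
      rw [← div_eq_mul_inv, div_le_div_iff₀ (by linarith) hy0]
      rw [div_lt_iff₀ hC00] at hNlt
      nlinarith
    have h2 : 1 / (M : ℝ) ^ 2 ≤ y ^ (-α) := by
      rw [hneg, ← one_div, ← hsq]
      exact one_div_le_one_div_of_le (by positivity) (pow_le_pow_left₀ (by positivity) hMge 2)
    have h3 : 0 ≤ c0 ^ α * y ^ (-α) := by positivity
    calc _ ≤ d * (r + 1) ^ d * ((2 * c0) ^ α * y ^ (-α)) +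
          2 ^ d * (r + 1) ^ d * (2 ^ D' * y ^ (-α)) := by gcongr
      _ ≤ _ := by nlinarith


/-- **Norm-based approximation of Hölder spaces.** For `d ≥ 1`, `α = r + β`,
there are constants `c, c′ > 0` depending only on `d` and `α` such that for every `K ≥ 1`
and every `h` in the unit ball of `C^α([0,1]^d)`, and every width
`W ≥ c′ K^{(2d+α)/(d(D+1)+2)}` with `D = 2⌈log₂(d+r)⌉ + 2`, there exists
`φ ∈ NN(W, D, K)` with `sup_{x∈[0,1]^d} |h(x) − φ(x)| ≤ c K^{−2α/(2+d(D+1))}`. -/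
theorem holder_approximation (d r : ℕ) (hd : 1 ≤ d) (β : ℝ) (hβ : β ∈ Set.Ioc (0 : ℝ) 1)
    (D : ℕ) (hD : D = 2 * Nat.clog 2 (d + r) + 2) :
    ∃ c : ℝ, 0 < c ∧ ∃ c' : ℝ, 0 < c' ∧
      ∀ K : ℝ, 1 ≤ K →
        ∀ h : (Fin d → ℝ) → ℝ, HolderUnitBall r β (cube d 0 1) h →
          ∀ W : ℕ,
            c' * K ^ ((2 * (d : ℝ) + ((r : ℝ) + β)) / ((d : ℝ) * ((D : ℝ) + 1) + 2))
              ≤ (W : ℝ) →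
            ∃ φ ∈ NNclass d 1 W D K,
              ∀ x ∈ cube d 0 1,
                |h x - φ x 0| ≤ c * K ^ (-(2 * ((r : ℝ) + β)) / (2 + (d : ℝ) * ((D : ℝ) + 1))) := by
  obtain ⟨hβ0, hβ1⟩ := hβ
  set D' : ℕ := 2 * Nat.clog 2 (d + r) + 1 with hD'
  have hDD : D = D' + 1 := by omega
  have hpow : d * (r + 1) ≤ 2 ^ D' := by
    have h1 : d + r ≤ 2 ^ Nat.clog 2 (d + r) := Nat.le_pow_clog (by norm_num) _
    rw [hD', pow_succ, mul_comm 2, pow_mul]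
    nlinarith
  have hC := C0_ge d r D'
  have hα0 : 0 < (r : ℝ) + β := by positivity
  refine ⟨d * (r + 1) ^ d * (2 * C0 d r D') ^ ((r : ℝ) + β)
        + 2 ^ d * (r + 1) ^ d * 2 ^ D' + C0 d r D' ^ ((r : ℝ) + β), by positivity,
    2 ^ d * (r + 1) ^ d * 2 ^ D' * 8, by positivity, ?_⟩
  intro K hK h hh W hW
  have hK0 : 0 < K := by linarith
  have hE0 : (0 : ℝ) < (d : ℝ) * ((D : ℝ) + 1) + 2 := by positivity
  set E : ℝ := (d : ℝ) * ((D : ℝ) + 1) + 2 with hE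
  have hEn : E = ((d * (D' + 2) + 2 : ℕ) : ℝ) := by rw [hE, hDD]; push_cast; ring
  have hyp : ∀ t : ℝ, (K ^ (2 / E)) ^ t = K ^ (2 / E * t) := fun t => (Real.rpow_mul hK0.le _ _).symm
  have key := final_aux d r hd β hβ0 D' hpow K (K ^ (2 / E)) hK
    (Real.one_le_rpow hK (by positivity)) (by
      rw [← Real.rpow_natCast (K ^ (2 / E)), hyp, ← hEn, div_mul_cancel₀ _ hE0.ne']
      exact_mod_cast Real.rpow_natCast K 2) h hh W (by
      rw [hyp]
      have e : 2 / E * ((d : ℝ) + ((r : ℝ) + β) / 2) = (2 * (d : ℝ) + ((r : ℝ) + β)) / E := by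
        field_simp
      rw [e]; exact hW)
  have e2 : 2 / E * (-((r : ℝ) + β)) = -(2 * ((r : ℝ) + β)) / (2 + (d : ℝ) * ((D : ℝ) + 1)) := by
    rw [add_comm (2 : ℝ), ← hE]; ring
  rw [hyp, e2, ← hDD] at key
  exact key
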